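/- arXiv:0810.1829 — 4 statements merged into one kernel-verified Lean document; each statement's English description precedes it below -/
import Mathlib

section
/- (Granville–Zagier sum formula.) For all integers k > n ≥ 1, ∑ ζ(k_1, …, k_n) = ζ(k), where the sum ranges over all tuples (k_1, …, k_n) of positive integers with k_1 + ⋯ + k_n = k and k_1 ≥ 2. -/
open scoped BigOperators

/-- Multiple zeta value `ζ(k_1,…,k_r) = ∑_{m_1 > ⋯ > m_r > 0} 1/(m_1^{k_1} ⋯ m_r^{k_r})`. -/
noncomputable def mzv (ks : List ℕ) : ℝ :=
  ∑' m : Fin ks.length → ℕ,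
    if (∀ i, 0 < m i) ∧ (∀ i j, i < j → m j < m i) then
      1 / ∏ i, (m i : ℝ) ^ ks.get i
    else 0

open scoped ENNReal
open Filter Topology

theorem prod_one_sub_tendsto_zero {e : ℕ → ℝ} (h0 : ∀ l, 0 ≤ e l) (h1 : ∀ l, e l ≤ 1)
    (hs : Tendsto (fun m => ∑ l ∈ Finset.range m, e l) atTop atTop) :
    Tendsto (fun m => ∏ l ∈ Finset.range m, (1 - e l)) atTop (𝓝 0) := by
  have hP (m : ℕ) : 0 ≤ ∏ l ∈ Finset.range m, (1 - e l) :=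
    Finset.prod_nonneg fun l _ => sub_nonneg.2 (h1 l)
  have hS (m : ℕ) : 0 ≤ ∑ l ∈ Finset.range m, e l := Finset.sum_nonneg fun l _ => h0 l
  have key (m : ℕ) :
      (∏ l ∈ Finset.range m, (1 - e l)) * (1 + ∑ l ∈ Finset.range m, e l) ≤ 1 := by
    induction m with
    | zero => simp
    | succ m ih =>
      rw [Finset.prod_range_succ, Finset.sum_range_succ]
      nlinarith [mul_nonneg (hP m) (mul_nonneg (h0 m) (hS m)),
        mul_nonneg (hP m) (mul_nonneg (h0 m) (h0 m))]
  have hlim : Tendsto (fun m => (1 + ∑ l ∈ Finset.range m, e l)⁻¹) atTop (𝓝 0) :=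
    tendsto_inv_atTop_zero.comp (tendsto_atTop_add_const_left _ 1 hs)
  refine squeeze_zero hP (fun m => ?_) hlim
  rw [← one_div, le_div_iff₀ (by linarith [hS m])]
  exact key m

/-- The terms of the shifted series whose sum over `m` is `∑_{M ≥ N} 1 / ((M+1-x)(M+1-y))`. -/
noncomputable def shiftedTerm (x y : ℝ) (N m : ℕ) : ℝ :=
  1 / ((m + 1) * (m + 1 + N - x)) *
    ∏ l ∈ Finset.range m, ((l + 1 - x + y) / (l + 1 + N - x))

theorem shiftedTerm_nonneg {x y : ℝ} (hx1 : x < 1) (hy0 : 0 ≤ y)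
    (N m : ℕ) : 0 ≤ shiftedTerm x y N m := by
  have hN : (0 : ℝ) ≤ N := N.cast_nonneg
  refine mul_nonneg (div_nonneg zero_le_one (mul_nonneg (by positivity) ?_))
    (Finset.prod_nonneg fun l _ => div_nonneg ?_ ?_)
  · linarith [(m.cast_nonneg : (0 : ℝ) ≤ m)]
  · linarith [(l.cast_nonneg : (0 : ℝ) ≤ l)]
  · linarith [(l.cast_nonneg : (0 : ℝ) ≤ l)]

theorem shiftedTerm_succ_le {x y : ℝ} (hx1 : x < 1) (hy0 : 0 ≤ y)
    (hy1 : y < 1) (N m : ℕ) :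
    shiftedTerm x y (N + 1) m ≤ 1 / ((m + 1) * (m + 1 + N)) := by
  have hN : (0 : ℝ) ≤ N := N.cast_nonneg
  have hm : (0 : ℝ) ≤ m := m.cast_nonneg
  have hprod : ∏ l ∈ Finset.range m,
      ((l + 1 - x + y) / (l + 1 + ((N + 1 : ℕ) : ℝ) - x)) ≤ 1 := by
    refine Finset.prod_le_one (fun l _ => ?_) (fun l _ => ?_)
    all_goals have hl : (0 : ℝ) ≤ l := l.cast_nonneg
    all_goals push_cast
    · exact div_nonneg (by linarith) (by linarith)
    · rw [div_le_one (by linarith)]; linarith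
  refine (mul_le_of_le_one_right ?_ hprod).trans ?_
  all_goals push_cast
  · exact div_nonneg zero_le_one (mul_nonneg (by positivity) (by linarith))
  · exact one_div_le_one_div_of_le (by positivity)
      (mul_le_mul_of_nonneg_left (by linarith) (by positivity))

theorem hasSum_shiftedTerm_sub {x y : ℝ} (hx0 : 0 ≤ x) (hx1 : x < 1) (hy0 : 0 ≤ y) (hy1 : y < 1)
    (N : ℕ) :
    HasSum (fun m => shiftedTerm x y N m - shiftedTerm x y (N + 1) m)
      (1 / ((N + 1 - x) * (N + 1 - y))) := by
  have hN : (0 : ℝ) ≤ N := N.cast_nonneg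
  have hcast (l : ℕ) : (0 : ℝ) ≤ l := l.cast_nonneg
  set U : ℕ → ℝ := fun m => ∏ l ∈ Finset.range m, ((l + 1 - x + y) / (l + 2 + N - x)) with hU
  have hlim : Tendsto U atTop (𝓝 0) := by
    have := prod_one_sub_tendsto_zero (e := fun l : ℕ => (N + 1 - y) / (l + 2 + N - x))
      (fun l => div_nonneg (by linarith) (by linarith [hcast l]))
      (fun l => by rw [div_le_one (by linarith [hcast l])]; linarith [hcast l]) ?_
    · refine this.congr fun m => Finset.prod_congr rfl fun l _ => ?_
      have : (l + 2 + N - x : ℝ) ≠ 0 := by linarith [hcast l]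
      field_simp
      ring
    · have hc : 0 < (N + 1 - y) / (N + 2 : ℝ) := div_pos (by linarith) (by linarith)
      refine tendsto_atTop_mono (fun m => ?_)
        (Real.tendsto_sum_range_one_div_nat_succ_atTop.const_mul_atTop hc)
      rw [Finset.mul_sum]
      refine Finset.sum_le_sum fun l _ => ?_
      rw [div_mul_div_comm, mul_one]
      exact div_le_div_of_nonneg_left (by linarith) (by linarith [hcast l])
        (by nlinarith [hcast l])
  have hterm (m : ℕ) : shiftedTerm x y N m - shiftedTerm x y (N + 1) m
      = 1 / ((N + 1 - x) * (N + 1 - y)) * (U m - U (m + 1)) := by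
    have hm := hcast m
    have hP : (N + 1 - x) * ∏ l ∈ Finset.range m, ((l + 1 - x + y) / (l + 1 + N - x))
        = (m + 1 + N - x) * U m := by
      clear hlim
      induction m with
      | zero => simp [hU]; ring
      | succ m ih =>
        have hm := hcast m
        have h1 : (m + 1 + N - x : ℝ) ≠ 0 := by linarith
        have h2 : (m + 2 + N - x : ℝ) ≠ 0 := by linarith
        simp only [hU] at ih ⊢
        rw [Finset.prod_range_succ, Finset.prod_range_succ, ← mul_assoc, ih hm]
        push_cast
        field_simp
        ring
    have h0 : (N + 1 - x : ℝ) ≠ 0 := by linarith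
    have h1 : (m + 1 + N - x : ℝ) ≠ 0 := by linarith
    have h2 : (m + 2 + N - x : ℝ) ≠ 0 := by linarith
    have h3 : (N + 1 - y : ℝ) ≠ 0 := by linarith
    have hP' : ∏ l ∈ Finset.range m, ((l + 1 - x + y) / (l + 1 + N - x))
        = (m + 1 + N - x) * U m / (N + 1 - x) := by
      rw [← hP]; field_simp
    have hQ : ∏ l ∈ Finset.range m, ((l + 1 - x + y) / (l + 1 + ((N + 1 : ℕ) : ℝ) - x)) = U m :=
      Finset.prod_congr rfl fun l _ => by push_cast; ring_nf
    have hU' : U (m + 1) = U m * ((m + 1 - x + y) / (m + 2 + N - x)) :=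
      Finset.prod_range_succ _ _
    rw [shiftedTerm, shiftedTerm, hP', hQ, hU']
    have h4 : (m + 1 + ((N + 1 : ℕ) : ℝ) - x) = m + 2 + N - x := by push_cast; ring
    rw [h4]
    have h5 : (m + 1 : ℝ) ≠ 0 := by positivity
    field_simp
    ring
  rw [hasSum_iff_tendsto_nat_of_nonneg]
  · simp_rw [hterm, ← Finset.mul_sum, Finset.sum_range_sub']
    have := (hlim.const_sub (U 0)).const_mul (1 / ((N + 1 - x) * (N + 1 - y)))
    simpa [hU] using this
  · intro m
    rw [hterm]
    refine mul_nonneg (div_nonneg zero_le_one (mul_nonneg (by linarith) (by linarith))) ?_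
    have hU' : U (m + 1) = U m * ((m + 1 - x + y) / (m + 2 + N - x)) :=
      Finset.prod_range_succ _ _
    rw [hU', sub_nonneg]
    refine mul_le_of_le_one_right (Finset.prod_nonneg fun l _ => ?_) ?_
    · exact div_nonneg (by linarith [hcast l]) (by linarith [hcast l])
    · rw [div_le_one (by linarith [hcast m])]; linarith [hcast m]

theorem summable_shiftedTerm {x y : ℝ} (hx0 : 0 ≤ x) (hx1 : x < 1) (hy0 : 0 ≤ y) (hy1 : y < 1)
    (N : ℕ) : Summable (shiftedTerm x y N) := by
  have h : Summable (shiftedTerm x y (N + 1)) := by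
    refine Summable.of_nonneg_of_le (shiftedTerm_nonneg hx1 hy0 _)
      (fun m => (shiftedTerm_succ_le hx1 hy0 hy1 N m).trans ?_)
      ((summable_nat_add_iff 1).2 (Real.summable_one_div_nat_pow.2 one_lt_two))
    push_cast
    rw [sq]
    exact one_div_le_one_div_of_le (by positivity)
      (mul_le_mul_of_nonneg_left (by linarith [(N.cast_nonneg : (0 : ℝ) ≤ N)]) (by positivity))
  simpa using (hasSum_shiftedTerm_sub hx0 hx1 hy0 hy1 N).summable.add h

theorem tendsto_tsum_shiftedTerm {x y : ℝ} (hx1 : x < 1) (hy0 : 0 ≤ y)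
    (hy1 : y < 1) : Tendsto (fun N => ∑' m, shiftedTerm x y N m) atTop (𝓝 0) := by
  rw [← tendsto_add_atTop_iff_nat 1]
  suffices h : Tendsto (fun N => ∑' m, shiftedTerm x y (N + 1) m) atTop (𝓝 (∑' _ : ℕ, (0 : ℝ))) by
    rwa [tsum_zero] at h
  have hsum : Summable fun m : ℕ => 1 / ((m + 1 : ℕ) : ℝ) ^ 2 :=
    (summable_nat_add_iff (f := fun m : ℕ => 1 / (m : ℝ) ^ 2) 1).2
      (Real.summable_one_div_nat_pow.2 one_lt_two)
  refine tendsto_tsum_of_dominated_convergence hsum (fun m => ?_)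
    (Eventually.of_forall fun N m => ?_)
  · refine squeeze_zero (fun N => shiftedTerm_nonneg hx1 hy0 _ _)
      (fun N => (shiftedTerm_succ_le hx1 hy0 hy1 N m).trans ?_)
      (tendsto_one_div_add_atTop_nhds_zero_nat (𝕜 := ℝ))
    exact one_div_le_one_div_of_le (by positivity)
      (by nlinarith [(m.cast_nonneg : (0 : ℝ) ≤ m), (N.cast_nonneg : (0 : ℝ) ≤ N)])
  · rw [Real.norm_of_nonneg (shiftedTerm_nonneg hx1 hy0 _ _)]
    refine (shiftedTerm_succ_le hx1 hy0 hy1 N m).trans ?_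
    push_cast
    rw [sq]
    exact one_div_le_one_div_of_le (by positivity)
      (mul_le_mul_of_nonneg_left (by linarith [(N.cast_nonneg : (0 : ℝ) ≤ N)]) (by positivity))

theorem hasSum_one_div_mul_sub {x y : ℝ} (hx0 : 0 ≤ x) (hx1 : x < 1) (hy0 : 0 ≤ y) (hy1 : y < 1) :
    HasSum (fun N : ℕ => 1 / ((N + 1 - x) * (N + 1 - y))) (∑' m, shiftedTerm x y 0 m) := by
  rw [hasSum_iff_tendsto_nat_of_nonneg]
  · have key (K : ℕ) : ∑ N ∈ Finset.range K, 1 / ((N + 1 - x) * (N + 1 - y))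
        = ∑' m, shiftedTerm x y 0 m - ∑' m, shiftedTerm x y K m := by
      rw [← Finset.sum_range_sub' (fun N => ∑' m, shiftedTerm x y N m)]
      refine Finset.sum_congr rfl fun N _ => ?_
      rw [← (hasSum_shiftedTerm_sub hx0 hx1 hy0 hy1 N).tsum_eq,
        (summable_shiftedTerm hx0 hx1 hy0 hy1 N).tsum_sub
          (summable_shiftedTerm hx0 hx1 hy0 hy1 (N + 1))]
    simp_rw [key]
    simpa using (tendsto_tsum_shiftedTerm hx1 hy0 hy1).const_sub (∑' m, shiftedTerm x y 0 m)
  · intro N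
    have hN : (0 : ℝ) ≤ N := N.cast_nonneg
    exact div_nonneg zero_le_one (mul_nonneg (by linarith) (by linarith))

theorem ENNReal.tsum_mul_pow_eq_add (f : ℕ → ℝ≥0∞) (x : ℝ≥0∞) :
    ∑' n, f n * x ^ n = f 0 + x * ∑' n, f (n + 1) * x ^ n := by
  rw [tsum_eq_zero_add' ENNReal.summable, ← ENNReal.tsum_mul_left, pow_zero, mul_one]
  congr 1
  exact tsum_congr fun n => by ring

theorem ENNReal.le_of_tsum_mul_pow_eq {a b : ℕ → ℝ≥0∞}
    (h : ∀ x : ℝ, 0 < x → x < 1 →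
      ∑' n, a n * ENNReal.ofReal x ^ n = ∑' n, b n * ENNReal.ofReal x ^ n)
    (hb : ∀ x : ℝ, 0 < x → x < 1 → ∑' n, b n * ENNReal.ofReal x ^ n ≠ ∞) : a 0 ≤ b 0 := by
  set c := ENNReal.ofReal (1 / 2) with hc
  have hc0 : c ≠ 0 := by simp [hc]
  set C := ∑' n, b (n + 1) * c ^ n with hC
  have hCfin : C ≠ ∞ := by
    intro hinf
    apply hb (1 / 2) (by norm_num) (by norm_num)
    rw [ENNReal.tsum_mul_pow_eq_add, ← hc, ← hC, hinf, ENNReal.mul_top hc0, add_top]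
  have hlim : Tendsto (fun x : ℝ => b 0 + ENNReal.ofReal x * C) (𝓝[>] 0) (𝓝 (b 0)) := by
    have h1 : Tendsto (fun x : ℝ => ENNReal.ofReal x) (𝓝[>] 0) (𝓝 0) := by
      simpa using (ENNReal.continuous_ofReal.tendsto 0).mono_left nhdsWithin_le_nhds
    simpa using (ENNReal.Tendsto.mul_const h1 (Or.inr hCfin)).const_add (b 0)
  refine ge_of_tendsto hlim ?_
  filter_upwards [Ioo_mem_nhdsGT (show (0 : ℝ) < 1 / 2 by norm_num)] with x hx
  calc a 0 ≤ ∑' n, a n * ENNReal.ofReal x ^ n := by rw [ENNReal.tsum_mul_pow_eq_add]; exact le_self_add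
    _ = _ := h x hx.1 (by linarith [hx.2])
    _ = b 0 + ENNReal.ofReal x * ∑' n, b (n + 1) * ENNReal.ofReal x ^ n := ENNReal.tsum_mul_pow_eq_add _ _
    _ ≤ _ := by
      gcongr
      exact ENNReal.tsum_le_tsum fun n => by gcongr; exact ENNReal.ofReal_le_ofReal hx.2.le

theorem ENNReal.eq_of_tsum_mul_pow_eq {a b : ℕ → ℝ≥0∞}
    (h : ∀ x : ℝ, 0 < x → x < 1 →
      ∑' n, a n * ENNReal.ofReal x ^ n = ∑' n, b n * ENNReal.ofReal x ^ n)
    (hb : ∀ x : ℝ, 0 < x → x < 1 → ∑' n, b n * ENNReal.ofReal x ^ n ≠ ∞) (n : ℕ) :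
    a n = b n := by
  induction n generalizing a b with
  | zero =>
    refine le_antisymm (ENNReal.le_of_tsum_mul_pow_eq h hb)
      (ENNReal.le_of_tsum_mul_pow_eq (fun x h0 h1 => (h x h0 h1).symm) fun x h0 h1 => ?_)
    rw [h x h0 h1]; exact hb x h0 h1
  | succ n ih =>
    have h00 : a 0 = b 0 := by
      refine le_antisymm (ENNReal.le_of_tsum_mul_pow_eq h hb)
        (ENNReal.le_of_tsum_mul_pow_eq (fun x h0 h1 => (h x h0 h1).symm) fun x h0 h1 => ?_)
      rw [h x h0 h1]; exact hb x h0 h1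
    refine ih (a := fun n => a (n + 1)) (b := fun n => b (n + 1)) (fun x h0 h1 => ?_)
      fun x h0 h1 hinf => ?_
    · have hfin := hb x h0 h1
      have := h x h0 h1
      rw [ENNReal.tsum_mul_pow_eq_add] at hfin
      rw [ENNReal.tsum_mul_pow_eq_add, ENNReal.tsum_mul_pow_eq_add b, h00] at this
      have hb0 : b 0 ≠ ∞ := fun hh => hfin (by rw [hh, top_add])
      exact (ENNReal.mul_right_inj (by simpa using h0) ENNReal.ofReal_ne_top).1
        ((ENNReal.add_right_inj hb0).1 this)
    · apply hb x h0 h1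
      rw [ENNReal.tsum_mul_pow_eq_add, hinf, ENNReal.mul_top (by simpa using h0), add_top]

/-- Truncated multiple zeta sum over `M ≥ m_1 > ⋯ > m_r > 0`. -/
noncomputable def truncMzv : List ℕ → ℕ → ℝ≥0∞
  | [], _ => 1
  | k :: ks, M => ∑ m ∈ Finset.range M, ENNReal.ofReal (1 / (m + 1)) ^ k * truncMzv ks m

/-- The multiple zeta sum restricted to indices satisfying `p`, valued in `[0, ∞]`. -/
noncomputable def restrictedMzv (p : ℕ → Prop) (ks : List ℕ) : ℝ≥0∞ :=
  open scoped Classical in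
  ∑' m : Fin ks.length → ℕ,
    if ((∀ i, 0 < m i) ∧ (∀ i j, i < j → m j < m i)) ∧ ∀ i, p (m i) then
      ENNReal.ofReal (1 / ∏ i, (m i : ℝ) ^ ks.get i)
    else 0

open scoped Classical in
theorem restrictedMzv_cons (p : ℕ → Prop) (hp : ∀ a b, a ≤ b → p b → p a) (k : ℕ)
    (ks : List ℕ) :
    restrictedMzv p (k :: ks) = ∑' a : ℕ, if p (a + 1) then
      ENNReal.ofReal (1 / (a + 1)) ^ k * restrictedMzv (· ≤ a) ks else 0 := by
  have hiff (a : ℕ) (m : Fin ks.length → ℕ) :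
      (((∀ i, 0 < (Fin.cons a m : Fin (ks.length + 1) → ℕ) i) ∧
        (∀ i j, i < j → (Fin.cons a m : Fin (ks.length + 1) → ℕ) j
          < (Fin.cons a m : Fin (ks.length + 1) → ℕ) i)) ∧
        ∀ i, p ((Fin.cons a m : Fin (ks.length + 1) → ℕ) i)) ↔
      0 < a ∧ p a ∧ (((∀ i, 0 < m i) ∧ (∀ i j, i < j → m j < m i)) ∧ ∀ i, m i ≤ a - 1) := by
    simp only [Fin.forall_fin_succ, Fin.cons_zero, Fin.cons_succ, Fin.succ_lt_succ_iff,
      Fin.succ_pos, Fin.not_lt_zero, false_imp_iff, true_imp_iff, true_and]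
    constructor
    · rintro ⟨⟨⟨h1, h2⟩, h3, h4⟩, h5, h6⟩
      exact ⟨h1, h5, ⟨h2, h4⟩, fun i => Nat.le_sub_one_of_lt (h3 i)⟩
    · rintro ⟨h1, h5, ⟨h2, h4⟩, h3⟩
      exact ⟨⟨⟨h1, h2⟩, fun i => by have := h3 i; omega, h4⟩, h5,
        fun i => hp _ a (by have := h3 i; omega) h5⟩
  have hstep : restrictedMzv p (k :: ks) = ∑' a : ℕ, ∑' m : Fin ks.length → ℕ,
      if 0 < a ∧ p a ∧ (((∀ i, 0 < m i) ∧ (∀ i j, i < j → m j < m i)) ∧ ∀ i, m i ≤ a - 1) then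
        ENNReal.ofReal (1 / ((a : ℝ) ^ k * ∏ i, (m i : ℝ) ^ ks.get i)) else 0 := by
    rw [← ENNReal.tsum_prod, restrictedMzv]
    refine ((Fin.consEquiv fun _ : Fin (ks.length + 1) => ℕ).tsum_eq _).symm.trans ?_
    refine tsum_congr fun am => ?_
    refine if_congr (hiff am.1 am.2) ?_ rfl
    congr 2
    exact Fin.prod_univ_succ _
  rw [hstep, tsum_eq_zero_add' ENNReal.summable]
  simp only [lt_irrefl, false_and, if_false, tsum_zero, zero_add]
  refine tsum_congr fun a => ?_
  by_cases hpa : p (a + 1)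
  · simp only [hpa, Nat.succ_pos, true_and, if_true, restrictedMzv, Nat.add_sub_cancel]
    rw [← ENNReal.tsum_mul_left]
    refine tsum_congr fun m => ?_
    rw [mul_ite, mul_zero]
    split_ifs
    swap
    · rfl
    rw [← ENNReal.ofReal_pow (by positivity), ← ENNReal.ofReal_mul (by positivity)]
    congr 1
    push_cast
    rw [div_pow, one_pow, one_div_mul_one_div]
  · simp [hpa]

theorem restrictedMzv_le (ks : List ℕ) (M : ℕ) :
    restrictedMzv (· ≤ M) ks = truncMzv ks M := by
  induction ks generalizing M with
  | nil =>
    rw [restrictedMzv, tsum_eq_single (fun i => i.elim0)]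
    · simp [truncMzv]
    · intro m hm
      exact absurd (Subsingleton.elim (α := Fin 0 → ℕ) _ _) hm
  | cons k ks ih =>
    rw [restrictedMzv_cons _ (fun a b h h' => h.trans h'), truncMzv,
      tsum_eq_sum (s := Finset.range M)]
    · refine Finset.sum_congr rfl fun m hm => ?_
      rw [if_pos (Nat.succ_le_of_lt (Finset.mem_range.1 hm)), ih]
    · intro m hm
      rw [if_neg]
      simpa [Nat.succ_le_iff] using hm

theorem mzv_cons (k : ℕ) (ks : List ℕ) :
    mzv (k :: ks) =
      (∑' m : ℕ, ENNReal.ofReal (1 / (m + 1)) ^ k * truncMzv ks m).toReal := by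
  have h : mzv (k :: ks) = (restrictedMzv (fun _ => True) (k :: ks)).toReal := by
    rw [mzv, restrictedMzv, ENNReal.tsum_toReal_eq]
    · refine tsum_congr fun m => ?_
      simp only [implies_true, and_true]
      split_ifs
      · rw [ENNReal.toReal_ofReal (by positivity)]
      · rfl
    · intro m
      split_ifs
      · exact ENNReal.ofReal_ne_top
      · exact ENNReal.zero_ne_top
  rw [h, restrictedMzv_cons _ (fun _ _ _ h => h)]
  simp only [if_true, restrictedMzv_le]

/-- Generating function, in the weight, of the truncated multiple zeta sums of depth `q`. -/
noncomputable def truncGen (X : ℝ≥0∞) (q M : ℕ) : ℝ≥0∞ :=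
  ∑' d : Fin q → ℕ, X ^ (∑ i, d i) * truncMzv (List.ofFn fun i => d i + 1) M

theorem tsum_pow_mul_pow_succ {x : ℝ} (hx0 : 0 ≤ x) (hx1 : x < 1) (m : ℕ) :
    ∑' a : ℕ, ENNReal.ofReal x ^ a * ENNReal.ofReal (1 / (m + 1)) ^ (a + 1)
      = ENNReal.ofReal (1 / (m + 1 - x)) := by
  have hm : (0 : ℝ) ≤ m := m.cast_nonneg
  have hr : x / (m + 1) < 1 := by rw [div_lt_one (by positivity)]; linarith
  have h := (hasSum_geometric_of_lt_one (div_nonneg hx0 (by positivity)) hr).mul_left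
    (1 / (m + 1 : ℝ))
  have hval : 1 / (m + 1 : ℝ) * (1 - x / (m + 1))⁻¹ = 1 / (m + 1 - x) := by
    have h1 : (m + 1 - x : ℝ) ≠ 0 := by linarith
    have h2 : (m + 1 : ℝ) ≠ 0 := by positivity
    rw [one_sub_div h2, inv_div]
    field_simp
  rw [hval] at h
  rw [← h.tsum_eq, ENNReal.ofReal_tsum_of_nonneg (fun n => by positivity) h.summable]
  refine tsum_congr fun a => ?_
  rw [← ENNReal.ofReal_pow hx0, ← ENNReal.ofReal_pow (by positivity),
    ← ENNReal.ofReal_mul (by positivity)]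
  congr 1
  rw [div_pow, div_pow, one_pow, pow_succ]
  field_simp

theorem tsum_fin_succ_pow_mul (X : ℝ≥0∞) (q : ℕ) (f : ℕ → (Fin q → ℕ) → ℝ≥0∞) :
    ∑' d : Fin (q + 1) → ℕ, X ^ (∑ i, d i) * f (d 0) (fun i => d i.succ)
      = ∑' a : ℕ, ∑' d : Fin q → ℕ, X ^ a * (X ^ (∑ i, d i) * f a d) := by
  rw [← ENNReal.tsum_prod]
  refine ((Fin.consEquiv fun _ : Fin (q + 1) => ℕ).tsum_eq _).symm.trans ?_
  refine tsum_congr fun ad => ?_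
  simp only [Fin.consEquiv_apply, Fin.cons_zero, Fin.cons_succ, Fin.sum_univ_succ, pow_add,
    mul_assoc]

theorem truncGen_succ {x : ℝ} (hx0 : 0 ≤ x) (hx1 : x < 1) (q M : ℕ) :
    truncGen (ENNReal.ofReal x) (q + 1) M = ∑ m ∈ Finset.range M,
      ENNReal.ofReal (1 / (m + 1 - x)) * truncGen (ENNReal.ofReal x) q m := by
  rw [truncGen]
  simp only [List.ofFn_succ, truncMzv]
  rw [tsum_fin_succ_pow_mul _ _ fun a d => ∑ m ∈ Finset.range M,
    ENNReal.ofReal (1 / (m + 1)) ^ (a + 1) * truncMzv (List.ofFn fun i => d i + 1) m]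
  simp only [Finset.mul_sum]
  simp only [Summable.tsum_finsetSum fun _ _ => ENNReal.summable]
  refine Finset.sum_congr rfl fun m _ => ?_
  rw [← tsum_pow_mul_pow_succ hx0 hx1, ← ENNReal.tsum_mul_right, truncGen]
  refine tsum_congr fun a => ?_
  rw [← ENNReal.tsum_mul_left]
  exact tsum_congr fun d => by ring

theorem tsum_truncGen_mul_pow {x : ℝ} (hx0 : 0 ≤ x) (hx1 : x < 1) (Y : ℝ≥0∞) (M : ℕ) :
    ∑' q, truncGen (ENNReal.ofReal x) q M * Y ^ q
      = ∏ l ∈ Finset.range M, (1 + Y * ENNReal.ofReal (1 / (l + 1 - x))) := by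
  have hrec (M : ℕ) : ∑' q, truncGen (ENNReal.ofReal x) q M * Y ^ q
      = 1 + Y * ∑ m ∈ Finset.range M, ENNReal.ofReal (1 / (m + 1 - x)) *
        ∑' q, truncGen (ENNReal.ofReal x) q m * Y ^ q := by
    rw [ENNReal.tsum_mul_pow_eq_add]
    congr 2
    · simp [truncGen, truncMzv]
    · simp only [truncGen_succ hx0 hx1, Finset.sum_mul, ← ENNReal.tsum_mul_left, mul_assoc]
      exact Summable.tsum_finsetSum fun _ _ => ENNReal.summable
  induction M with
  | zero => rw [hrec]; simp
  | succ M ih =>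
    rw [Finset.prod_range_succ, ← ih, hrec, Finset.sum_range_succ, mul_add, ← add_assoc, ← hrec]
    ring

/-- The sum of the multiple zeta values of depth `q + 1` and weight `p + q + 2`. -/
noncomputable def mzvWeightSum (p q : ℕ) : ℝ≥0∞ :=
  ∑ d ∈ Finset.Nat.antidiagonalTuple (q + 1) p,
    ∑' m : ℕ, ENNReal.ofReal (1 / (m + 1)) ^ (d 0 + 2) *
      truncMzv (List.ofFn fun i : Fin q => d i.succ + 1) m

theorem tsum_mzvWeightSum_mul_pow {x : ℝ} (hx0 : 0 ≤ x) (hx1 : x < 1) (q : ℕ) :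
    ∑' p, mzvWeightSum p q * ENNReal.ofReal x ^ p
      = ∑' m : ℕ, ENNReal.ofReal (1 / (m + 1)) * (ENNReal.ofReal (1 / (m + 1 - x)) *
        truncGen (ENNReal.ofReal x) q m) := by
  have hfiber : ∑' p, mzvWeightSum p q * ENNReal.ofReal x ^ p
      = ∑' d : Fin (q + 1) → ℕ, ENNReal.ofReal x ^ (∑ i, d i) *
        ∑' m : ℕ, ENNReal.ofReal (1 / (m + 1)) ^ (d 0 + 2) *
          truncMzv (List.ofFn fun i : Fin q => d i.succ + 1) m := by
    rw [← (Finset.Nat.sigmaAntidiagonalTupleEquivTuple (q + 1)).tsum_eq, ENNReal.tsum_sigma']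
    refine tsum_congr fun p => ?_
    rw [mzvWeightSum, Finset.sum_mul, tsum_fintype, ← Finset.sum_coe_sort]
    refine Finset.sum_congr rfl fun d _ => ?_
    have hd : ∑ i, d.1 i = p := Finset.Nat.mem_antidiagonalTuple.1 d.2
    rw [mul_comm]
    simp only [Finset.Nat.sigmaAntidiagonalTupleEquivTuple_apply, hd]
  rw [hfiber, tsum_fin_succ_pow_mul _ _ fun a d => ∑' m : ℕ,
    ENNReal.ofReal (1 / (m + 1)) ^ (a + 2) * truncMzv (List.ofFn fun i => d i + 1) m]
  simp only [← ENNReal.tsum_mul_left]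
  have hswap (a : ℕ) (f : (Fin q → ℕ) → ℕ → ℝ≥0∞) :
      ∑' d, ∑' m, f d m = ∑' m, ∑' d, f d m := ENNReal.tsum_comm
  simp only [hswap 0]
  rw [ENNReal.tsum_comm]
  refine tsum_congr fun m => ?_
  rw [← tsum_pow_mul_pow_succ hx0 hx1, ← ENNReal.tsum_mul_right, truncGen,
    ← ENNReal.tsum_mul_left]
  refine tsum_congr fun a => ?_
  rw [← ENNReal.tsum_mul_left, ← ENNReal.tsum_mul_left]
  exact tsum_congr fun d => by ring

theorem tsum_tsum_mzvWeightSum {x y : ℝ} (hx0 : 0 ≤ x) (hx1 : x < 1) (hy0 : 0 ≤ y) (hy1 : y < 1) :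
    ∑' q, (∑' p, mzvWeightSum p q * ENNReal.ofReal x ^ p) * ENNReal.ofReal y ^ q
      = ENNReal.ofReal (∑' m, shiftedTerm x y 0 m) := by
  rw [ENNReal.ofReal_tsum_of_nonneg (shiftedTerm_nonneg hx1 hy0 0)
    (summable_shiftedTerm hx0 hx1 hy0 hy1 0)]
  simp only [tsum_mzvWeightSum_mul_pow hx0 hx1, ← ENNReal.tsum_mul_right]
  rw [ENNReal.tsum_comm]
  refine tsum_congr fun m => ?_
  simp only [mul_assoc, ENNReal.tsum_mul_left, tsum_truncGen_mul_pow hx0 hx1]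
  have hcast (l : ℕ) : 0 < (l : ℝ) + 1 - x := by linarith [(l.cast_nonneg : (0 : ℝ) ≤ l)]
  rw [shiftedTerm, ENNReal.ofReal_mul (div_nonneg zero_le_one (by
      simpa using mul_nonneg (by positivity : (0 : ℝ) ≤ m + 1) (hcast m).le)),
    ENNReal.ofReal_prod_of_nonneg fun l _ => by
      simpa using div_nonneg (by linarith [hcast l]) (hcast l).le, ← mul_assoc,
    ← ENNReal.ofReal_mul (by positivity), one_div_mul_one_div]
  simp only [Nat.cast_zero, add_zero]
  congr 1
  refine Finset.prod_congr rfl fun l _ => ?_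
  have h := hcast l
  rw [← ENNReal.ofReal_one, ← ENNReal.ofReal_mul hy0,
    ← ENNReal.ofReal_add zero_le_one (by positivity)]
  congr 1
  field_simp

theorem tsum_tsum_zeta {x y : ℝ} (hx0 : 0 ≤ x) (hx1 : x < 1) (hy0 : 0 ≤ y) (hy1 : y < 1) :
    ∑' q, (∑' p, (∑' m : ℕ, ENNReal.ofReal (1 / (m + 1)) ^ (p + q + 2)) * ENNReal.ofReal x ^ p) *
        ENNReal.ofReal y ^ q
      = ENNReal.ofReal (∑' m, shiftedTerm x y 0 m) := by
  have hnn (m : ℕ) : 0 ≤ 1 / ((m + 1 - x) * (m + 1 - y)) := by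
    have hm : (0 : ℝ) ≤ m := m.cast_nonneg
    exact div_nonneg zero_le_one (mul_nonneg (by linarith) (by linarith))
  have h := hasSum_one_div_mul_sub hx0 hx1 hy0 hy1
  rw [← h.tsum_eq, ENNReal.ofReal_tsum_of_nonneg hnn h.summable]
  have hswap (f : ℕ → ℕ → ℝ≥0∞) :
      ∑' p, ∑' m, f p m = ∑' m, ∑' p, f p m := ENNReal.tsum_comm
  simp only [← ENNReal.tsum_mul_right, hswap (fun p m => _ * _ ^ p * _)]
  rw [ENNReal.tsum_comm]
  refine tsum_congr fun m => ?_
  have hm : (0 : ℝ) ≤ m := m.cast_nonneg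
  rw [← one_div_mul_one_div, ENNReal.ofReal_mul (div_nonneg zero_le_one (by linarith)),
    ← tsum_pow_mul_pow_succ hx0 hx1, ← tsum_pow_mul_pow_succ hy0 hy1, ← ENNReal.tsum_mul_left]
  refine tsum_congr fun q => ?_
  rw [← ENNReal.tsum_mul_right]
  exact tsum_congr fun p => by ring

theorem mzvWeightSum_eq (p q : ℕ) :
    mzvWeightSum p q = ∑' m : ℕ, ENNReal.ofReal (1 / (m + 1)) ^ (p + q + 2) := by
  have hfin {x : ℝ} (h0 : 0 < x) (h1 : x < 1) (q : ℕ) :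
      ∑' p, (∑' m : ℕ, ENNReal.ofReal (1 / (m + 1)) ^ (p + q + 2)) * ENNReal.ofReal x ^ p ≠ ∞ := by
    intro hinf
    have h2 := tsum_tsum_zeta (y := 1 / 2) h0.le h1 (by norm_num) (by norm_num)
    have h3 := ENNReal.ne_top_of_tsum_ne_top (h2.trans_ne ENNReal.ofReal_ne_top) q
    rw [hinf, ENNReal.top_mul (pow_ne_zero _ (by simp))] at h3
    exact h3 rfl
  refine ENNReal.eq_of_tsum_mul_pow_eq (a := fun p => mzvWeightSum p q)
    (b := fun p => ∑' m : ℕ, ENNReal.ofReal (1 / (m + 1)) ^ (p + q + 2)) (fun x h0 h1 => ?_)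
    (fun x h0 h1 => hfin h0 h1 q) p
  refine ENNReal.eq_of_tsum_mul_pow_eq
    (a := fun q => ∑' p, mzvWeightSum p q * ENNReal.ofReal x ^ p)
    (b := fun q => ∑' p, (∑' m : ℕ, ENNReal.ofReal (1 / (m + 1)) ^ (p + q + 2)) *
      ENNReal.ofReal x ^ p) (fun y hy0 hy1 => ?_) (fun y hy0 hy1 => ?_) q
  · rw [tsum_tsum_mzvWeightSum h0.le h1 hy0.le hy1, tsum_tsum_zeta h0.le h1 hy0.le hy1]
  · rw [tsum_tsum_zeta h0.le h1 hy0.le hy1]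
    exact ENNReal.ofReal_ne_top

theorem tsum_one_div_pow_ne_top (k : ℕ) :
    ∑' m : ℕ, ENNReal.ofReal (1 / (m + 1)) ^ (k + 2) ≠ ∞ := by
  have h : Summable fun m : ℕ => 1 / ((m + 1 : ℕ) : ℝ) ^ (k + 2) :=
    (summable_nat_add_iff (f := fun m : ℕ => 1 / (m : ℝ) ^ (k + 2)) 1).2
      (Real.summable_one_div_nat_pow.2 (by omega))
  convert h.tsum_ofReal_ne_top using 4 with m
  rw [← ENNReal.ofReal_pow (by positivity), div_pow, one_pow, Nat.cast_add_one]

theorem sum_positive_antidiagonalTuple (p q : ℕ) (g : (Fin (q + 1) → ℕ) → ℝ) :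
    ∑ c ∈ (Finset.Nat.antidiagonalTuple (q + 1) (p + q + 2)).filter
        (fun c => (∀ i, 0 < c i) ∧ ∀ i : Fin (q + 1), i.val = 0 → 2 ≤ c i), g c
      = ∑ d ∈ Finset.Nat.antidiagonalTuple (q + 1) p,
        g (Fin.cons (d 0 + 2) fun i : Fin q => d i.succ + 1) := by
  symm
  refine Finset.sum_nbij' (fun d => Fin.cons (d 0 + 2) fun i : Fin q => d i.succ + 1)
    (fun c => Fin.cons (c 0 - 2) fun i : Fin q => c i.succ - 1) ?_ ?_ ?_ ?_ ?_
  · intro d hd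
    rw [Finset.Nat.mem_antidiagonalTuple, Fin.sum_univ_succ] at hd
    rw [Finset.mem_filter, Finset.Nat.mem_antidiagonalTuple]
    refine ⟨?_, fun i => ?_, fun i hi => ?_⟩
    · simp only [Fin.sum_univ_succ, Fin.cons_zero, Fin.cons_succ, Finset.sum_add_distrib,
        Finset.sum_const, Finset.card_univ, Fintype.card_fin, smul_eq_mul]
      omega
    · cases i using Fin.cases <;> simp
    · obtain rfl : i = 0 := Fin.ext hi
      simp
  · intro c hc
    rw [Finset.mem_filter, Finset.Nat.mem_antidiagonalTuple, Fin.sum_univ_succ] at hc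
    obtain ⟨hsum, hpos, h2⟩ := hc
    have h0 := h2 0 rfl
    have hsucc : ∑ i : Fin q, c i.succ = ∑ i : Fin q, (c i.succ - 1) + q := by
      have : ∀ i : Fin q, c i.succ = (c i.succ - 1) + 1 := fun i => by
        have := hpos i.succ; omega
      rw [Finset.sum_congr rfl fun i _ => this i, Finset.sum_add_distrib]
      simp
    simp only [Finset.Nat.mem_antidiagonalTuple, Fin.sum_univ_succ, Fin.cons_zero, Fin.cons_succ]
    omega
  · intro d _
    ext i
    cases i using Fin.cases <;> simp
  · intro c hc
    obtain ⟨-, hpos, h2⟩ := Finset.mem_filter.1 hc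
    ext i
    cases i using Fin.cases with
    | zero => have := h2 0 rfl; simp only [Fin.cons_zero]; omega
    | succ i => have := hpos i.succ; simp only [Fin.cons_succ]; omega
  · intro d _
    rfl

/-- The Granville–Zagier sum formula: for `k > n ≥ 1`, the sum of `ζ(k_1,…,k_n)` over all
tuples of positive integers with `k_1 + ⋯ + k_n = k` and `k_1 ≥ 2` equals `ζ(k)`. -/
theorem granville_zagier_sum_formula (k n : ℕ) (hn : 1 ≤ n) (hk : n < k) :
    ∑ c ∈ (Finset.Nat.antidiagonalTuple n k).filter
        (fun c => (∀ i, 0 < c i) ∧ ∀ i : Fin n, i.val = 0 → 2 ≤ c i),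
      mzv (List.ofFn c) = mzv [k] := by
  obtain ⟨q, rfl⟩ := Nat.exists_eq_add_of_le' hn
  obtain ⟨p, rfl⟩ : ∃ p, k = p + q + 2 := ⟨k - (q + 2), by omega⟩
  have hsum := mzvWeightSum_eq p q
  have hfin := tsum_one_div_pow_ne_top (p + q)
  rw [← hsum, mzvWeightSum, ENNReal.sum_ne_top] at hfin
  rw [sum_positive_antidiagonalTuple]
  simp only [List.ofFn_cons, mzv_cons, truncMzv, mul_one]
  rw [← hsum, mzvWeightSum, ENNReal.toReal_sum hfin]
end

section
/- Let α, p ∈ ℂ and let ρ be the monoid homomorphism from the free monoid on {x, y} to 2×2 complex matrices determined by ρ(x) = [[0, 0],[α, α]] and ρ(y) = [[0, 0],[α, α+p]] (this is the β → 0 specialization of the representation ρ_∞ with ρ_∞(x) = [[0, β],[α, α+β]], ρ_∞(y) = [[0, 0],[α, α+β+p]]). Then for every nonempty word W: if W ends in the letter y, then ρ(W) = α^{|W|−d(W)} · (α+p)^{d(W)−1} · [[0, 0],[α, α+p]], and if W ends in the letter x, then ρ(W) = α^{|W|−d(W)} · (α+p)^{d(W)} · [[0, 0],[1, 1]], where |W|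 is the length of W and d(W) the number of occurrences of y in W. -/
open scoped BigOperators

/-- A word in the free monoid on two letters `{x, y}`, encoded as a `List Bool`
with `false = x` and `true = y`. The monoid homomorphism determined by
`x ↦ A`, `y ↦ B` sends a word to the product of the images of its letters. -/
noncomputable def wordRep (A B : Matrix (Fin 2) (Fin 2) ℂ) (W : List Bool) :
    Matrix (Fin 2) (Fin 2) ℂ :=
  (W.map fun b => if b then B else A).prod

/-- `d(W)`: the number of occurrences of the letter `y` in `W`. -/
def wordDepth (W : List Bool) : ℕ := W.count true

theorem length_sub_wordDepth (W : List Bool) :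
    W.length - wordDepth W = W.count false := by
  have := List.count_not_add_count W true
  simp only [Bool.not_true] at this
  rw [wordDepth]
  lia

theorem wordRep_mul_lowerRow (α q c d : ℂ) (V : List Bool) :
    wordRep !![0, 0; α, α] !![0, 0; α, q] V * !![0, 0; c, d] =
      (α ^ V.count false * q ^ V.count true) • !![0, 0; c, d] := by
  induction V with
  | nil => simp [wordRep]
  | cons b V ih =>
    simp only [wordRep, List.map_cons, List.prod_cons, Matrix.mul_assoc] at ih ⊢
    rw [ih]
    cases b <;> ext i j <;> fin_cases i <;> fin_cases j <;>
      simp [Matrix.mul_apply, Fin.sum_univ_two] <;> ring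

theorem wordRep_append_singleton (A B : Matrix (Fin 2) (Fin 2) ℂ) (V : List Bool) (b : Bool) :
    wordRep A B (V ++ [b]) = wordRep A B V * if b then B else A := by
  simp [wordRep]

/-- The `β → 0` specialization of the representation `ρ_∞`:
`ρ(x) = [[0,0],[α,α]]`, `ρ(y) = [[0,0],[α,α+p]]`. For a nonempty word `W`,
if `W` ends in `y` then `ρ(W) = α^{|W|−d(W)} (α+p)^{d(W)−1} [[0,0],[α,α+p]]`,
and if `W` ends in `x` then `ρ(W) = α^{|W|−d(W)} (α+p)^{d(W)} [[0,0],[1,1]]`. -/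
theorem rho_infty_beta_zero_word_eval (α p : ℂ) (W : List Bool) (hW : W ≠ []) :
    (W.getLast? = some true →
      wordRep !![0, 0; α, α] !![0, 0; α, α + p] W =
        (α ^ (W.length - wordDepth W) * (α + p) ^ (wordDepth W - 1)) •
          !![0, 0; α, α + p]) ∧
    (W.getLast? = some false →
      wordRep !![0, 0; α, α] !![0, 0; α, α + p] W =
        (α ^ (W.length - wordDepth W) * (α + p) ^ wordDepth W) • !![0, 0; 1, 1]) := by
  obtain ⟨V, b, rfl⟩ := (List.eq_nil_or_concat W).resolve_left hW
  rw [List.concat_eq_append, length_sub_wordDepth, wordRep_append_singleton]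
  cases b
  · simp [wordRep_mul_lowerRow, wordDepth, pow_succ]
    ring_nf
  · simp [wordRep_mul_lowerRow, wordDepth]
end

section
/- For every odd integer m ≥ 3, (m+2) · ζ(m+1) = 2 · ∑_{i,k ≥ 1, i+2k = m} ζ(i+1) · ζ(2k). -/
open scoped BigOperators

open PowerSeries in
/-- The differential equation of the generating function of the Bernoulli numbers. -/
theorem bernoulliPowerSeries_mul_self :
    bernoulliPowerSeries ℚ * bernoulliPowerSeries ℚ =
      bernoulliPowerSeries ℚ - X * bernoulliPowerSeries ℚ -
        X * derivative ℚ (bernoulliPowerSeries ℚ) := by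
  have h := bernoulliPowerSeries_mul_exp_sub_one ℚ
  have h' := congrArg (derivative ℚ) h
  rw [Derivation.leibniz, derivative_X, map_sub, derivative_exp, derivative_one, sub_zero,
    smul_eq_mul, smul_eq_mul] at h'
  linear_combination
    bernoulliPowerSeries ℚ * h' -
      (bernoulliPowerSeries ℚ + derivative ℚ (bernoulliPowerSeries ℚ)) * h

/-- The convolution of the sequence `bernoulli n / n !` with itself. -/
theorem sum_antidiagonal_bernoulli_div_factorial (N : ℕ) :
    ∑ p ∈ Finset.HasAntidiagonal.antidiagonal (N + 1),
        bernoulli p.1 / p.1.factorial * (bernoulli p.2 / p.2.factorial) =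
      -(N : ℚ) * (bernoulli (N + 1) / (N + 1).factorial) - bernoulli N / N.factorial := by
  have h := congrArg (PowerSeries.coeff (N + 1)) bernoulliPowerSeries_mul_self
  simp only [map_sub, PowerSeries.coeff_succ_X_mul] at h
  simp only [PowerSeries.coeff_mul, PowerSeries.coeff_derivative, bernoulliPowerSeries,
    PowerSeries.coeff_mk, Algebra.algebraMap_self, RingHom.id_apply] at h
  rw [h]
  ring

/-- Euler's convolution formula for Bernoulli numbers, summed over the pairs `i, k ≥ 1` with
`i + 2 * k = m`. -/
theorem sum_bernoulli_div_factorial_of_odd {m : ℕ} (hm : 3 ≤ m) (hodd : Odd m) :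
    ∑ p ∈ (Finset.range (m + 1) ×ˢ Finset.range (m + 1)).filter
        (fun p => 1 ≤ p.1 ∧ 1 ≤ p.2 ∧ p.1 + 2 * p.2 = m),
      bernoulli (p.1 + 1) / (p.1 + 1).factorial *
        (bernoulli (2 * p.2) / (2 * p.2).factorial) =
      -((m : ℚ) + 2) * (bernoulli (m + 1) / (m + 1).factorial) := by
  set S := (Finset.range (m + 1) ×ˢ Finset.range (m + 1)).filter
    (fun p => 1 ≤ p.1 ∧ 1 ≤ p.2 ∧ p.1 + 2 * p.2 = m) with hS
  let g : ℕ × ℕ → ℕ × ℕ := fun p => (p.1 + 1, 2 * p.2)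
  let f : ℕ × ℕ → ℚ := fun p =>
    bernoulli p.1 / p.1.factorial * (bernoulli p.2 / p.2.factorial)
  have hg : Set.InjOn g S := by
    rintro ⟨a, b⟩ - ⟨c, d⟩ - h
    simp only [g, Prod.mk.injEq] at h ⊢
    lia
  have hmem : ∀ p, p ∈ S ↔ 1 ≤ p.1 ∧ 1 ≤ p.2 ∧ p.1 + 2 * p.2 = m := by
    intro p
    simp only [hS, Finset.mem_filter, Finset.mem_product, Finset.mem_range]
    lia
  have hsub : insert (0, m + 1) (insert (m + 1, 0) (S.image g)) ⊆
      Finset.HasAntidiagonal.antidiagonal (m + 1) := by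
    intro p
    simp only [Finset.mem_insert, Finset.mem_image, Finset.HasAntidiagonal.mem_antidiagonal]
    rintro (rfl | rfl | ⟨q, hq, rfl⟩)
    · simp
    · simp
    · have := (hmem q).1 hq
      simp only [g]
      lia
  have hsum := Finset.sum_subset (f := f) hsub (by
    rintro ⟨a, b⟩ hab hnot
    rw [Finset.HasAntidiagonal.mem_antidiagonal] at hab
    simp only [Finset.mem_insert, Finset.mem_image, Prod.mk.injEq, not_or] at hnot
    obtain ⟨h0, h1, h2⟩ := hnot
    simp only at hab
    rcases Nat.even_or_odd b with hb | hb
    · obtain ⟨c, rfl⟩ := hb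
      obtain ⟨d, rfl⟩ := hodd
      refine absurd ⟨(a - 1, c), (hmem _).2 ?_, ?_⟩ h2
      · simp only
        lia
      · simp only [g, Prod.mk.injEq]
        lia
    · by_cases hb1 : b = 1
      · have ha : bernoulli a = 0 := bernoulli_eq_zero_of_odd (by grind) (by lia)
        simp [f, ha]
      · have hb' : bernoulli b = 0 := bernoulli_eq_zero_of_odd hb (by grind)
        simp [f, hb'])
  have hn1 : (m + 1, 0) ∉ S.image g := by
    simp only [Finset.mem_image, not_exists, not_and]
    intro q hq h
    have := (hmem q).1 hq
    simp only [g, Prod.mk.injEq] at h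
    lia
  have hn2 : (0, m + 1) ∉ insert (m + 1, 0) (S.image g) := by
    simp only [Finset.mem_insert, Finset.mem_image, not_or, not_exists, not_and]
    refine ⟨by simp, fun q hq h => ?_⟩
    simp only [g, Prod.mk.injEq] at h
    lia
  rw [Finset.sum_insert hn2, Finset.sum_insert hn1, Finset.sum_image hg,
    sum_antidiagonal_bernoulli_div_factorial, bernoulli_eq_zero_of_odd hodd (by lia)] at hsum
  simp only [f, g, bernoulli_zero, Nat.factorial_zero, Nat.cast_one] at hsum
  linear_combination hsum

theorem mzv_singleton {k : ℕ} (hk : k ≠ 0) : mzv [k] = ∑' n : ℕ, 1 / (n : ℝ) ^ k := by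
  unfold mzv
  rw [← (Equiv.funUnique (Fin 1) ℕ).tsum_eq]
  refine tsum_congr fun x => ?_
  have hx : (∀ i j : Fin [k].length, i < j → x j < x i) := by
    intro i j hij
    have := Subsingleton.elim (α := Fin 1) i j
    exact absurd this hij.ne
  have hprod : ∏ i : Fin [k].length, (x i : ℝ) ^ [k].get i = (x 0 : ℝ) ^ k :=
    Fin.prod_univ_one (fun i : Fin 1 => (x i : ℝ) ^ [k].get i)
  have hpos : (∀ i : Fin [k].length, 0 < x i) ↔ 0 < x 0 :=
    ⟨fun h => h 0, fun h i => (Subsingleton.elim (α := Fin 1) i 0) ▸ h⟩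
  rw [hprod]
  change _ = 1 / (x 0 : ℝ) ^ k
  split_ifs with h
  · rfl
  · have : x 0 = 0 := by
      by_contra h0
      exact h ⟨hpos.2 (Nat.pos_of_ne_zero h0), hx⟩
    simp [this, hk]

/-- Euler's formula for the zeta values at positive even integers. -/
theorem mzv_two_mul {k : ℕ} (hk : k ≠ 0) :
    mzv [2 * k] =
      -(1 / 2) * (-(4 * Real.pi ^ 2)) ^ k *
        ((bernoulli (2 * k) / (2 * k).factorial : ℚ) : ℝ) := by
  rw [mzv_singleton (by lia), (hasSum_zeta_nat hk).tsum_eq]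
  obtain ⟨j, rfl⟩ := Nat.exists_eq_succ_of_ne_zero hk
  have h4 : (-(4 * Real.pi ^ 2)) ^ (j + 1) =
      (-1) ^ (j + 1) * (2 * 2 ^ (2 * (j + 1) - 1)) * Real.pi ^ (2 * (j + 1)) := by
    rw [← pow_succ', show 2 * (j + 1) - 1 + 1 = 2 * (j + 1) by lia, pow_mul, pow_mul,
      ← mul_pow, ← mul_pow]
    norm_num
  rw [Nat.succ_eq_add_one, h4]
  push_cast
  ring

/-- For odd `m ≥ 3`:  `(m+2)·ζ(m+1) = 2·∑_{i,k ≥ 1, i+2k=m} ζ(i+1)·ζ(2k)`. -/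
theorem zeta_relation_odd (m : ℕ) (hm : 3 ≤ m) (hodd : Odd m) :
    ((m : ℝ) + 2) * mzv [m + 1] =
      2 * ∑ p ∈ (Finset.range (m + 1) ×ˢ Finset.range (m + 1)).filter
          (fun p => 1 ≤ p.1 ∧ 1 ≤ p.2 ∧ p.1 + 2 * p.2 = m),
        mzv [p.1 + 1] * mzv [2 * p.2] := by
  have hB := congrArg (Rat.cast : ℚ → ℝ) (sum_bernoulli_div_factorial_of_odd hm hodd)
  rw [Rat.cast_sum] at hB
  obtain ⟨n, hn⟩ : ∃ n, m + 1 = 2 * n := (hodd.add_one).two_dvd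
  have hterm : ∀ p ∈ (Finset.range (m + 1) ×ˢ Finset.range (m + 1)).filter
      (fun p => 1 ≤ p.1 ∧ 1 ≤ p.2 ∧ p.1 + 2 * p.2 = m),
      mzv [p.1 + 1] * mzv [2 * p.2] = 1 / 4 * (-(4 * Real.pi ^ 2)) ^ n *
        ((bernoulli (p.1 + 1) / (p.1 + 1).factorial *
          (bernoulli (2 * p.2) / (2 * p.2).factorial) : ℚ) : ℝ) := by
    intro p hp
    obtain ⟨h1, h2, h3⟩ := (Finset.mem_filter.1 hp).2
    obtain ⟨l, hl⟩ : ∃ l, p.1 + 1 = 2 * l := ⟨n - p.2, by lia⟩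
    rw [hl, mzv_two_mul (by lia), mzv_two_mul (by lia), show n = l + p.2 by lia, pow_add,
      Rat.cast_mul]
    ring
  rw [Finset.sum_congr rfl hterm, ← Finset.mul_sum, hB, hn, mzv_two_mul (by lia)]
  push_cast
  ring
end

section
/- For every even integer m ≥ 2, 2 · ζ(m, 1, 1) = m · ζ(m+1, 1) + (π²/2) · ζ(m) − ((m+1)(m+2)/2) · ζ(m+2) + ∑_{i,k ≥ 1, i+2k = m} (i+1) · ζ(i+2) · ζ(2k) + ∑_{i,j,k ≥ 1, i+j+2k = m} ζ(i+1) · ζ(j+1) · ζ(2k). -/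
open scoped BigOperators

namespace MZVRelation

open Filter Topology PowerSeries

/-- The weighted sum `∑_{k ≥ 0} e k / (k+1)^a`. -/
noncomputable def weightedZeta (e : ℕ → ℝ) (a : ℕ) : ℝ := ∑' k, e k / ((k : ℝ) + 1) ^ a

/-- The function `x ↦ ∑_{k ≥ 0} e k (1/(k+1)^r - 1/(k+1+x)^r)`. -/
noncomputable def shiftSum (e : ℕ → ℝ) (r : ℕ) (x : ℝ) : ℝ :=
  ∑' k, e k * (1 / ((k : ℝ) + 1) ^ r - 1 / ((k : ℝ) + 1 + x) ^ r)

/-- A weight for which `∑ e k / (k+1)^2` is a convergent series of nonnegative terms. -/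
structure Admissible (e : ℕ → ℝ) : Prop where
  nonneg : ∀ k, 0 ≤ e k
  summable : Summable fun k => e k / ((k : ℝ) + 1) ^ 2

/-- The weight `k ↦ ∑_{j < k} e j / (j+1)`. -/
noncomputable def nest (e : ℕ → ℝ) (k : ℕ) : ℝ := ∑ j ∈ Finset.range k, e j / ((j : ℝ) + 1)

lemma admissible_one : Admissible fun _ => 1 := by
  refine ⟨fun _ => zero_le_one, ?_⟩
  have := (summable_nat_add_iff 1).2 (Real.summable_one_div_nat_pow.2 (one_lt_two))
  exact_mod_cast this

lemma Admissible.summable_div_mul {e : ℕ → ℝ} (he : Admissible e) :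
    Summable fun k => e k / (((k : ℝ) + 1) * ((k : ℝ) + 2)) := by
  refine he.summable.of_nonneg_of_le (fun k => ?_) (fun k => ?_)
  · have := he.nonneg k
    positivity
  · have := he.nonneg k
    gcongr
    nlinarith

lemma Admissible.of_summable_div_mul {e : ℕ → ℝ} (h0 : ∀ k, 0 ≤ e k)
    (hs : Summable fun k => e k / (((k : ℝ) + 1) * ((k : ℝ) + 2))) : Admissible e := by
  refine ⟨h0, (hs.mul_left 2).of_nonneg_of_le (fun k => ?_) (fun k => ?_)⟩
  · have := h0 k
    positivity
  · have := h0 k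
    rw [← mul_div_assoc, div_le_div_iff₀ (by positivity) (by positivity)]
    have hk : (0 : ℝ) ≤ k := k.cast_nonneg
    nlinarith [mul_nonneg this hk, mul_nonneg (mul_nonneg this hk) hk]

lemma nest_nonneg {e : ℕ → ℝ} (he : Admissible e) (k : ℕ) : 0 ≤ nest e k :=
  Finset.sum_nonneg fun j _ => by
    have := he.nonneg j
    positivity

lemma nest_succ (e : ℕ → ℝ) (k : ℕ) : nest e (k + 1) = nest e k + e k / ((k : ℝ) + 1) := by
  simp [nest, Finset.sum_range_succ]

lemma nest_mono {e : ℕ → ℝ} (he : Admissible e) : Monotone (nest e) :=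
  monotone_nat_of_le_succ fun k => by
    have := he.nonneg k
    rw [nest_succ, le_add_iff_nonneg_right]
    positivity

/-- Summation by parts for the differences of `1/(k+1+x)` against `nest e`. -/
lemma nest_mul_sub (e : ℕ → ℝ) {x : ℝ} (hx : -1 < x) (k : ℕ) :
    nest e k * (1 / ((k : ℝ) + 1 + x) - 1 / ((k : ℝ) + 1 + (x + 1))) =
      (nest e k / ((k : ℝ) + 1 + x) - nest e (k + 1) / (((k + 1 : ℕ) : ℝ) + 1 + x)) +
        e k / (((k : ℝ) + 1) * ((k : ℝ) + 1 + (x + 1))) := by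
  have hk : (0 : ℝ) ≤ k := k.cast_nonneg
  have h1 : (k : ℝ) + 1 + x ≠ 0 := by linarith
  have h2 : (k : ℝ) + 1 + (x + 1) ≠ 0 := by linarith
  have h3 : (k : ℝ) + 1 ≠ 0 := by linarith
  rw [nest_succ]
  push_cast
  rw [show (k : ℝ) + 1 + 1 + x = (k : ℝ) + 1 + (x + 1) by ring]
  field_simp
  ring

lemma Admissible.nest {e : ℕ → ℝ} (he : Admissible e) : Admissible (nest e) := by
  refine .of_summable_div_mul (nest_nonneg he) ?_
  refine summable_of_sum_range_le (c := ∑' k, e k / (((k : ℝ) + 1) * ((k : ℝ) + 2)))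
    (fun k => div_nonneg (nest_nonneg he k) (by positivity)) fun n => ?_
  have key : ∀ k : ℕ, MZVRelation.nest e k / (((k : ℝ) + 1) * ((k : ℝ) + 2)) =
      (MZVRelation.nest e k / ((k : ℝ) + 1 + 0) -
        MZVRelation.nest e (k + 1) / (((k + 1 : ℕ) : ℝ) + 1 + 0)) +
        e k / (((k : ℝ) + 1) * ((k : ℝ) + 2)) := fun k => by
    have := nest_mul_sub e (x := 0) (by norm_num) k
    rw [show (k : ℝ) + 1 + (0 + 1) = (k : ℝ) + 2 by ring] at this
    rw [← this]
    field_simp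
    ring
  rw [Finset.sum_congr rfl fun k _ => key k, Finset.sum_add_distrib, Finset.sum_range_sub']
  have h1 : ∑ k ∈ Finset.range n, e k / (((k : ℝ) + 1) * ((k : ℝ) + 2)) ≤
      ∑' k, e k / (((k : ℝ) + 1) * ((k : ℝ) + 2)) :=
    he.summable_div_mul.sum_le_tsum _ fun k _ => by
      have := he.nonneg k
      positivity
  have h2 : 0 ≤ MZVRelation.nest e n / ((n : ℝ) + 1 + 0) :=
    div_nonneg (nest_nonneg he n) (by positivity)
  have h3 : MZVRelation.nest e 0 = 0 := by simp [MZVRelation.nest]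
  rw [h3]
  linarith

/-- A monotone admissible weight is `o(k)`. -/
lemma Admissible.tendsto_div {e : ℕ → ℝ} (he : Admissible e) (hm : Monotone e) :
    Tendsto (fun k : ℕ => e k / ((k : ℝ) + 1)) atTop (𝓝 0) := by
  have hs := he.summable_div_mul
  have ht : Tendsto (fun n : ℕ => ∑' k : ℕ, e (k + n) / ((((k + n : ℕ) : ℝ) + 1) *
      (((k + n : ℕ) : ℝ) + 2))) atTop (𝓝 0) :=
    tendsto_sum_nat_add fun k : ℕ => e k / (((k : ℝ) + 1) * ((k : ℝ) + 2))
  refine squeeze_zero (fun k => div_nonneg (he.nonneg k) (by positivity)) (fun n => ?_) ht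
  have hsn : Summable fun k : ℕ => e (k + n) / ((((k + n : ℕ) : ℝ) + 1) *
      (((k + n : ℕ) : ℝ) + 2)) :=
    (summable_nat_add_iff (f := fun k : ℕ => e k / (((k : ℝ) + 1) * ((k : ℝ) + 2))) n).2 hs
  have hlim : Tendsto (fun N : ℕ => e n * (1 / ((n : ℝ) + 1) - 1 / (((N + n : ℕ) : ℝ) + 1)))
      atTop (𝓝 (e n * (1 / ((n : ℝ) + 1) - 0))) := by
    refine tendsto_const_nhds.mul (tendsto_const_nhds.sub ?_)
    exact (tendsto_one_div_add_atTop_nhds_zero_nat (𝕜 := ℝ)).comp (tendsto_add_atTop_nat n)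
  have : e n / ((n : ℝ) + 1) = e n * (1 / ((n : ℝ) + 1) - 0) := by ring
  rw [this]
  refine le_of_tendsto_of_tendsto' hlim hsn.hasSum.tendsto_sum_nat fun N => ?_
  have h0 := Finset.sum_range_sub' (fun k : ℕ => 1 / (((k + n : ℕ) : ℝ) + 1)) N
  simp only [zero_add] at h0
  rw [← h0, Finset.mul_sum]
  refine Finset.sum_le_sum fun k _ => ?_
  have h1 := hm (Nat.le_add_left n k)
  have h2 : 1 / (((k + n : ℕ) : ℝ) + 1) - 1 / (((k + 1 + n : ℕ) : ℝ) + 1) =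
      1 / ((((k + n : ℕ) : ℝ) + 1) * (((k + n : ℕ) : ℝ) + 2)) := by
    push_cast
    field_simp
    ring
  rw [h2, div_eq_mul_one_div (e (k + n))]
  gcongr

lemma one_div_pow_sub_bound {r : ℕ} {x : ℝ} (hx : -1 < x) :
    ∃ C : ℝ, ∀ k : ℕ, |1 / ((k : ℝ) + 1) ^ r - 1 / ((k : ℝ) + 1 + x) ^ r| ≤
      C * (1 / ((k : ℝ) + 1) ^ 2) := by
  induction r with
  | zero => exact ⟨0, fun k => by simp⟩
  | succ r ih =>
    obtain ⟨C, hC⟩ := ih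
    obtain ⟨c, hc0, hc1, hc⟩ : ∃ c : ℝ, 0 < c ∧ c ≤ 1 ∧ c ≤ 1 + x :=
      ⟨min 1 (1 + x), by rw [lt_min_iff]; constructor <;> linarith, min_le_left _ _,
        min_le_right _ _⟩
    refine ⟨C + |x| / c * (1 / c) ^ r, fun k => ?_⟩
    have hk : (0 : ℝ) ≤ k := k.cast_nonneg
    have hp : (0 : ℝ) < (k : ℝ) + 1 := by positivity
    have hcx : c * ((k : ℝ) + 1) ≤ (k : ℝ) + 1 + x := by nlinarith
    have hq : 0 < (k : ℝ) + 1 + x := lt_of_lt_of_le (by positivity) hcx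
    have hinv : 1 / ((k : ℝ) + 1 + x) ≤ 1 / (c * ((k : ℝ) + 1)) := by gcongr
    have h1 : 1 / ((k : ℝ) + 1) ^ (r + 1) - 1 / ((k : ℝ) + 1 + x) ^ (r + 1) =
        1 / ((k : ℝ) + 1) * (1 / ((k : ℝ) + 1) ^ r - 1 / ((k : ℝ) + 1 + x) ^ r) +
        (x / ((k : ℝ) + 1) * (1 / ((k : ℝ) + 1 + x))) * (1 / ((k : ℝ) + 1 + x)) ^ r := by
      rw [div_pow, one_pow]
      field_simp
      ring
    have h2 : |1 / ((k : ℝ) + 1) * (1 / ((k : ℝ) + 1) ^ r - 1 / ((k : ℝ) + 1 + x) ^ r)| ≤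
        C * (1 / ((k : ℝ) + 1) ^ 2) := by
      rw [abs_mul, abs_of_pos (by positivity)]
      refine le_trans (mul_le_of_le_one_left (abs_nonneg _) ?_) (hC k)
      rw [div_le_one hp]
      linarith
    have h3 : |(x / ((k : ℝ) + 1) * (1 / ((k : ℝ) + 1 + x))) * (1 / ((k : ℝ) + 1 + x)) ^ r| ≤
        (|x| / c * (1 / c) ^ r) * (1 / ((k : ℝ) + 1) ^ 2) := by
      rw [abs_mul, abs_mul, abs_div, abs_of_pos hp, abs_of_pos (one_div_pos.2 hq), abs_pow,
        abs_of_pos (one_div_pos.2 hq)]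
      have h4 : 1 / ((k : ℝ) + 1 + x) ≤ 1 / c := hinv.trans (by gcongr; nlinarith)
      calc |x| / ((k : ℝ) + 1) * (1 / ((k : ℝ) + 1 + x)) * (1 / ((k : ℝ) + 1 + x)) ^ r
          ≤ |x| / ((k : ℝ) + 1) * (1 / (c * ((k : ℝ) + 1))) * (1 / c) ^ r := by gcongr
        _ = _ := by field_simp
    rw [h1, add_mul]
    exact (abs_add_le _ _).trans (add_le_add h2 h3)

lemma Admissible.summable_shift {e : ℕ → ℝ} (he : Admissible e) (r : ℕ) {x : ℝ} (hx : -1 < x) :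
    Summable fun k : ℕ => e k * (1 / ((k : ℝ) + 1) ^ r - 1 / ((k : ℝ) + 1 + x) ^ r) := by
  obtain ⟨C, hC⟩ := one_div_pow_sub_bound (r := r) hx
  refine .of_norm_bounded (he.summable.mul_left C) fun k => ?_
  rw [Real.norm_eq_abs, abs_mul, abs_of_nonneg (he.nonneg k)]
  calc e k * |1 / ((k : ℝ) + 1) ^ r - 1 / ((k : ℝ) + 1 + x) ^ r|
      ≤ e k * (C * (1 / ((k : ℝ) + 1) ^ 2)) := mul_le_mul_of_nonneg_left (hC k) (he.nonneg k)
    _ = _ := by ring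

lemma shiftSum_zero (e : ℕ → ℝ) (r : ℕ) : shiftSum e r 0 = 0 := by simp [shiftSum]

lemma shiftSum_le {e : ℕ → ℝ} (he : Admissible e) (r : ℕ) {x y : ℝ} (hx : -1 < x) (hxy : x ≤ y) :
    shiftSum e r x ≤ shiftSum e r y := by
  refine (he.summable_shift r hx).tsum_le_tsum (fun k => ?_)
    (he.summable_shift r (hx.trans_le hxy))
  have hk : (0 : ℝ) ≤ k := k.cast_nonneg
  have h1 : 0 < (k : ℝ) + 1 + x := by linarith
  refine mul_le_mul_of_nonneg_left ?_ (he.nonneg k)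
  gcongr

lemma shiftSum_nonneg {e : ℕ → ℝ} (he : Admissible e) (r : ℕ) {x : ℝ} (hx : 0 ≤ x) :
    0 ≤ shiftSum e r x := by
  simpa [shiftSum_zero] using shiftSum_le he r (by norm_num) hx

lemma summable_shift_diff {e : ℕ → ℝ} (he : Admissible e) (r : ℕ) {x : ℝ} (hx : -1 < x) :
    Summable fun k : ℕ =>
      e k * (1 / ((k : ℝ) + 1 + x) ^ r - 1 / ((k : ℝ) + 1 + (x + 1)) ^ r) := by
  exact ((he.summable_shift r (show -1 < x + 1 by linarith)).sub
    (he.summable_shift r hx)).congr fun k => by ring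

lemma shiftSum_add_one_sub {e : ℕ → ℝ} (he : Admissible e) (r : ℕ) {x : ℝ} (hx : -1 < x) :
    shiftSum e r (x + 1) - shiftSum e r x =
      ∑' k : ℕ, e k * (1 / ((k : ℝ) + 1 + x) ^ r - 1 / ((k : ℝ) + 1 + (x + 1)) ^ r) := by
  rw [shiftSum, shiftSum, ← (he.summable_shift r (by linarith)).tsum_sub (he.summable_shift r hx)]
  exact tsum_congr fun k => by ring

lemma tendsto_one_div_add (x : ℝ) : Tendsto (fun n : ℕ => 1 / ((n : ℝ) + 1 + x)) atTop (𝓝 0) := by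
  simp only [one_div]
  refine tendsto_inv_atTop_zero.comp ?_
  simp only [add_assoc]
  exact tendsto_atTop_add_const_right _ _ tendsto_natCast_atTop_atTop

/-- Functional equation for the constant weight. -/
lemma shiftSum_one_add_one {r : ℕ} (hr : r ≠ 0) {x : ℝ} (hx : -1 < x) :
    shiftSum (fun _ => 1) r (x + 1) = shiftSum (fun _ => 1) r x + (1 / (x + 1)) ^ r := by
  rw [← sub_eq_iff_eq_add', shiftSum_add_one_sub admissible_one r hx]
  refine tendsto_nhds_unique
    (summable_shift_diff admissible_one r hx).hasSum.tendsto_sum_nat ?_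
  have h : ∀ n : ℕ, ∑ k ∈ Finset.range n,
      1 * (1 / ((k : ℝ) + 1 + x) ^ r - 1 / ((k : ℝ) + 1 + (x + 1)) ^ r) =
      (1 / (x + 1)) ^ r - (1 / ((n : ℝ) + 1 + x)) ^ r := fun n => by
    have := Finset.sum_range_sub' (fun k : ℕ => (1 / ((k : ℝ) + 1 + x)) ^ r) n
    rw [Nat.cast_zero, zero_add, add_comm 1 x] at this
    rw [← this]
    refine Finset.sum_congr rfl fun k _ => ?_
    push_cast
    rw [one_mul, one_div_pow, one_div_pow, show (k : ℝ) + 1 + 1 + x = (k : ℝ) + 1 + (x + 1) by ring]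
  simp only [h]
  have := tendsto_const_nhds (x := (1 / (x + 1)) ^ r).sub ((tendsto_one_div_add x).pow r)
  simpa [hr] using this

/-- Functional equation for nested weights. -/
lemma shiftSum_nest_add_one {e : ℕ → ℝ} (he : Admissible e) {x : ℝ} (hx : -1 < x) :
    shiftSum (nest e) 1 (x + 1) =
      shiftSum (nest e) 1 x + 1 / (x + 1) * shiftSum e 1 (x + 1) := by
  have hx1 : x + 1 ≠ 0 := by linarith
  have hs1 := summable_shift_diff he.nest 1 hx
  have hs2 := he.summable_shift 1 (show -1 < x + 1 by linarith)
  have hterm : ∀ k : ℕ, e k / (((k : ℝ) + 1) * ((k : ℝ) + 1 + (x + 1))) =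
      1 / (x + 1) * (e k * (1 / ((k : ℝ) + 1) ^ 1 - 1 / ((k : ℝ) + 1 + (x + 1)) ^ 1)) :=
    fun k => by
      have hk : (0 : ℝ) ≤ k := k.cast_nonneg
      have h2 : (k : ℝ) + 1 + (x + 1) ≠ 0 := by linarith
      field_simp
      ring
  rw [← sub_eq_iff_eq_add', shiftSum_add_one_sub he.nest 1 hx, shiftSum, ← tsum_mul_left]
  refine tendsto_nhds_unique hs1.hasSum.tendsto_sum_nat ?_
  have h : ∀ n : ℕ, ∑ k ∈ Finset.range n,
      nest e k * (1 / ((k : ℝ) + 1 + x) ^ 1 - 1 / ((k : ℝ) + 1 + (x + 1)) ^ 1) =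
      -(nest e n / ((n : ℝ) + 1 + x)) + ∑ k ∈ Finset.range n,
        1 / (x + 1) * (e k * (1 / ((k : ℝ) + 1) ^ 1 - 1 / ((k : ℝ) + 1 + (x + 1)) ^ 1)) :=
    fun n => by
      simp only [← hterm]
      simp only [pow_one]
      rw [Finset.sum_congr rfl fun k _ => nest_mul_sub e hx k, Finset.sum_add_distrib,
        Finset.sum_range_sub' fun k : ℕ => nest e k / ((k : ℝ) + 1 + x)]
      simp [nest]
  simp only [h]
  have hb : Tendsto (fun n : ℕ => nest e n / ((n : ℝ) + 1 + x)) atTop (𝓝 0) := by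
    have h1 := he.nest.tendsto_div (nest_mono he)
    have h2 : Tendsto (fun n : ℕ => 1 - x * (1 / ((n : ℝ) + 1 + x))) atTop (𝓝 (1 - x * 0)) :=
      tendsto_const_nhds.sub ((tendsto_one_div_add x).const_mul x)
    have h3 := h1.mul h2
    rw [zero_mul] at h3
    refine h3.congr fun n => ?_
    have hk : (0 : ℝ) ≤ n := n.cast_nonneg
    have h4 : (n : ℝ) + 1 + x ≠ 0 := by linarith
    field_simp
    ring
  have h5 := hb.neg.add (hs2.mul_left (1 / (x + 1))).hasSum.tendsto_sum_nat
  simpa using h5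

lemma tendsto_shiftSum_diff {e : ℕ → ℝ} (he : Admissible e) :
    Tendsto (fun n : ℕ => shiftSum e 1 ((n : ℝ) + 1) - shiftSum e 1 n) atTop (𝓝 0) := by
  have hn : ∀ n : ℕ, (-1 : ℝ) < n := fun n => by linarith [n.cast_nonneg (α := ℝ)]
  simp only [fun n : ℕ => shiftSum_add_one_sub he 1 (hn n)]
  rw [← tsum_zero (α := ℝ) (β := ℕ)]
  refine tendsto_tsum_of_dominated_convergence he.summable_div_mul (fun k => ?_)
    (Eventually.of_forall fun n k => ?_)
  · have h1 : Tendsto (fun n : ℕ => 1 / ((k : ℝ) + 1 + n) ^ 1) atTop (𝓝 0) := by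
      refine (tendsto_one_div_add k).congr fun n => ?_
      rw [pow_one, show (n : ℝ) + 1 + k = k + 1 + n by ring]
    have h2 := h1.comp (tendsto_add_atTop_nat 1)
    simpa using ((h1.sub h2).const_mul (e k))
  · have hk : (0 : ℝ) ≤ k := k.cast_nonneg
    have hn' : (0 : ℝ) ≤ n := n.cast_nonneg
    have h1 : 1 / ((k : ℝ) + 1 + n) ^ 1 - 1 / ((k : ℝ) + 1 + (n + 1)) ^ 1 =
        1 / (((k : ℝ) + 1 + n) * ((k : ℝ) + 2 + n)) := by
      field_simp
      ring
    have h0 := he.nonneg k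
    rw [h1, Real.norm_eq_abs, abs_of_nonneg (by positivity), ← div_eq_mul_one_div]
    refine div_le_div_of_nonneg_left h0 (by positivity) (mul_le_mul ?_ ?_ ?_ ?_) <;> linarith

/-- Two monotone functions with the same value at `0` and the same increments over unit steps
agree, provided that their increments at the integers tend to zero. -/
lemma eq_of_add_one_sub_eq {f g : ℝ → ℝ} (hf : MonotoneOn f (Set.Ici 0))
    (hg : MonotoneOn g (Set.Ici 0)) (h0 : f 0 = g 0)
    (hstep : ∀ x, -1 < x → f (x + 1) - f x = g (x + 1) - g x)
    (hlim : Tendsto (fun n : ℕ => f ((n : ℝ) + 1) - f n) atTop (𝓝 0)) {x : ℝ}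
    (hx : -1 < x) : f x = g x := by
  have hper : ∀ (n : ℕ) (y : ℝ), -1 < y → f (y + n) - g (y + n) = f y - g y := by
    intro n y hy
    induction n with
    | zero => simp
    | succ n ih =>
      have := hstep (y + n) (by linarith [n.cast_nonneg (α := ℝ)])
      push_cast
      rw [← add_assoc]
      linarith
  have hnat : ∀ n : ℕ, f n = g n := fun n => by
    have := hper n 0 (by norm_num)
    rw [zero_add] at this
    linarith
  have hpos : ∀ y : ℝ, 0 ≤ y → y ≤ 1 → f y = g y := by
    intro y hy0 hy1
    rw [← sub_eq_zero, ← abs_nonpos_iff]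
    refine ge_of_tendsto' hlim fun n => ?_
    have hn : (0 : ℝ) ≤ n := n.cast_nonneg
    rw [← hper n y (by linarith)]
    have m1 : (n : ℝ) ∈ Set.Ici (0 : ℝ) := hn
    have m2 : y + n ∈ Set.Ici (0 : ℝ) := Set.mem_Ici.2 (by linarith)
    have m3 : (n : ℝ) + 1 ∈ Set.Ici (0 : ℝ) := Set.mem_Ici.2 (by linarith)
    have f1 := hf m1 m2 (by linarith)
    have f2 := hf m2 m3 (by linarith)
    have g1 := hg m1 m2 (by linarith)
    have g2 := hg m2 m3 (by linarith)
    have e1 := hnat n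
    have e2 := hnat (n + 1)
    push_cast at e2
    rw [abs_le]
    constructor <;> linarith
  rcases le_or_gt 0 x with h | h
  · have h1 := hper ⌊x⌋₊ (x - ⌊x⌋₊) (by linarith [Nat.floor_le h])
    have h2 := hpos (x - ⌊x⌋₊) (by linarith [Nat.floor_le h]) (by linarith [Nat.lt_floor_add_one x])
    rw [sub_add_cancel] at h1
    linarith
  · have h1 := hpos (x + 1) (by linarith) (by linarith)
    have h2 := hstep x hx
    linarith

/-- The power series `a` converges absolutely to `f` on `(-1, 1)`. -/
structure HasExpansion (a : PowerSeries ℝ) (f : ℝ → ℝ) : Prop where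
  summable : ∀ x ∈ Set.Ioo (-1 : ℝ) 1, Summable fun n => ‖coeff n a * x ^ n‖
  tsum_eq : ∀ x ∈ Set.Ioo (-1 : ℝ) 1, ∑' n, coeff n a * x ^ n = f x

namespace HasExpansion

variable {a b : PowerSeries ℝ} {f g : ℝ → ℝ}

lemma add (ha : HasExpansion a f) (hb : HasExpansion b g) :
    HasExpansion (a + b) fun x => f x + g x where
  summable x hx := by
    refine ((ha.summable x hx).add (hb.summable x hx)).of_nonneg_of_le (fun _ => norm_nonneg _)
      fun n => ?_
    rw [map_add, add_mul]
    exact norm_add_le _ _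
  tsum_eq x hx := by
    rw [← ha.tsum_eq x hx, ← hb.tsum_eq x hx,
      ← (ha.summable x hx).of_norm.tsum_add (hb.summable x hx).of_norm]
    exact tsum_congr fun n => by rw [map_add, add_mul]

lemma smul (ha : HasExpansion a f) (c : ℝ) : HasExpansion (c • a) fun x => c * f x where
  summable x hx := by
    refine ((ha.summable x hx).mul_left ‖c‖).congr fun n => ?_
    rw [map_smul, smul_eq_mul, mul_assoc, norm_mul c]
  tsum_eq x hx := by
    rw [← ha.tsum_eq x hx, ← tsum_mul_left]
    exact tsum_congr fun n => by rw [map_smul, smul_eq_mul, mul_assoc]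

lemma mul (ha : HasExpansion a f) (hb : HasExpansion b g) :
    HasExpansion (a * b) fun x => f x * g x := by
  have h : ∀ x : ℝ, (fun n => coeff n (a * b) * x ^ n) =
      fun n => ∑ kl ∈ Finset.HasAntidiagonal.antidiagonal n,
        (fun k => coeff k a * x ^ k) kl.1 * (fun k => coeff k b * x ^ k) kl.2 := fun x => by
    ext n
    rw [coeff_mul, Finset.sum_mul]
    refine Finset.sum_congr rfl fun kl hkl => ?_
    rw [← Finset.HasAntidiagonal.mem_antidiagonal.1 hkl, pow_add]
    ring
  refine ⟨fun x hx => ?_, fun x hx => ?_⟩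
  · have := summable_norm_sum_mul_antidiagonal_of_summable_norm (ha.summable x hx)
      (hb.summable x hx)
    exact this.congr fun n => by rw [congrFun (h x) n]
  · rw [h x, ← ha.tsum_eq x hx, ← hb.tsum_eq x hx,
      tsum_mul_tsum_eq_tsum_sum_antidiagonal_of_summable_norm (ha.summable x hx)
        (hb.summable x hx)]

lemma eq_of_eqOn (ha : HasExpansion a f) (hb : HasExpansion b g)
    (h : ∀ x ∈ Set.Ioo (-1 : ℝ) 1, f x = g x) : a = b := by
  have hp : ∀ {c : PowerSeries ℝ} {u : ℝ → ℝ}, HasExpansion c u →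
      (∀ x ∈ Set.Ioo (-1 : ℝ) 1, f x = u x) →
      HasFPowerSeriesAt f (FormalMultilinearSeries.ofScalars ℝ fun n => coeff n c) 0 := by
    intro c u hc hu
    rw [hasFPowerSeriesAt_iff]
    filter_upwards [Ioo_mem_nhds (show (-1 : ℝ) < 0 by norm_num) one_pos] with x hx
    rw [zero_add, hu x hx, ← hc.tsum_eq x hx]
    convert (hc.summable x hx).of_norm.hasSum using 2 with n
    simp [FormalMultilinearSeries.coeff_ofScalars, mul_comm]
  have := (hp ha fun _ _ => rfl).eq_formalMultilinearSeries (hp hb h)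
  ext n
  simpa [FormalMultilinearSeries.coeff_ofScalars] using
    congrArg (fun p => FormalMultilinearSeries.coeff p n) this

end HasExpansion

/-- The Taylor series of `x ↦ -shiftSum e (r+1) (-x)`. -/
noncomputable def shiftSeries (e : ℕ → ℝ) (r : ℕ) : PowerSeries ℝ :=
  .mk fun m => if m = 0 then 0 else ((m + r).choose r : ℝ) * weightedZeta e (m + r + 1)

lemma hasExpansion_shiftSeries {e : ℕ → ℝ} (he : Admissible e) (r : ℕ) :
    HasExpansion (shiftSeries e r) fun x => -shiftSum e (r + 1) (-x) := by
  have key : ∀ x ∈ Set.Ioo (-1 : ℝ) 1, Summable (fun p : ℕ × ℕ =>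
      ‖(if p.1 = 0 then 0 else ((p.1 + r).choose r : ℝ) * x ^ p.1) *
        (e p.2 / ((p.2 : ℝ) + 1) ^ (p.1 + r + 1))‖) := by
    intro x hx
    have hx1 : ‖|x|‖ < 1 := by rw [norm_abs_eq_norm, Real.norm_eq_abs, abs_lt]; exact hx
    have hs := (summable_choose_mul_geometric_of_norm_lt_one r hx1).mul_of_nonneg he.summable
      (fun n => by simp only [Pi.zero_apply]; positivity)
      (fun k => by have := he.nonneg k; simp only [Pi.zero_apply]; positivity)
    refine hs.of_nonneg_of_le (fun _ => norm_nonneg _) ?_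
    rintro ⟨m, k⟩
    have h0 := he.nonneg k
    dsimp only
    split_ifs with hm
    · simp only [zero_mul, norm_zero]
      positivity
    · rw [norm_mul, norm_mul, norm_pow, Real.norm_eq_abs x, Real.norm_natCast,
        Real.norm_of_nonneg (by positivity)]
      have hk : (1 : ℝ) ≤ (k : ℝ) + 1 := by linarith [k.cast_nonneg (α := ℝ)]
      gcongr
      omega
  have hco : ∀ (x : ℝ) (m : ℕ), coeff m (shiftSeries e r) * x ^ m =
      ∑' k, (if m = 0 then 0 else ((m + r).choose r : ℝ) * x ^ m) *
        (e k / ((k : ℝ) + 1) ^ (m + r + 1)) := fun x m => by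
    rw [tsum_mul_left, shiftSeries, coeff_mk, weightedZeta]
    split_ifs <;> ring
  refine ⟨fun x hx => ?_, fun x hx => ?_⟩
  · simp only [hco]
    refine ((key x hx).prod).of_nonneg_of_le (fun _ => norm_nonneg _) fun m => ?_
    exact norm_tsum_le_tsum_norm ((key x hx).prod_factor m)
  · simp only [hco]
    rw [← Summable.tsum_comm (f := fun m k : ℕ =>
      (if m = 0 then 0 else ((m + r).choose r : ℝ) * x ^ m) *
        (e k / ((k : ℝ) + 1) ^ (m + r + 1))) (key x hx).of_norm, shiftSum, ← tsum_neg]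
    refine tsum_congr fun k => ?_
    have hk : (0 : ℝ) ≤ k := k.cast_nonneg
    have hk1 : (0 : ℝ) < (k : ℝ) + 1 := by positivity
    have hy : ‖x / ((k : ℝ) + 1)‖ < 1 := by
      rw [norm_div, Real.norm_eq_abs, Real.norm_of_nonneg hk1.le, div_lt_one hk1]
      have := abs_lt.2 hx
      linarith
    have h1 := (hasSum_choose_mul_geometric_of_norm_lt_one r hy).mul_left
      (e k / ((k : ℝ) + 1) ^ (r + 1))
    have h2 : HasSum (fun m : ℕ => if m = 0 then e k / ((k : ℝ) + 1) ^ (r + 1) else 0)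
      (e k / ((k : ℝ) + 1) ^ (r + 1)) := hasSum_ite_eq 0 _
    have h3 := h1.sub h2
    have h4 : (k : ℝ) + 1 + -x ≠ 0 := by linarith [hx.2]
    have h5 : 1 - x / ((k : ℝ) + 1) = ((k : ℝ) + 1 + -x) / (k + 1) := by
      field_simp
      ring
    have h6 : -(e k * (1 / ((k : ℝ) + 1) ^ (r + 1) - 1 / ((k : ℝ) + 1 + -x) ^ (r + 1))) =
        e k / ((k : ℝ) + 1) ^ (r + 1) * (1 / (1 - x / ((k : ℝ) + 1)) ^ (r + 1)) -
          e k / ((k : ℝ) + 1) ^ (r + 1) := by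
      rw [h5, div_pow]
      field_simp
      ring
    rw [h6, ← h3.tsum_eq]
    refine tsum_congr fun m => ?_
    split_ifs with hm
    · simp [hm]
    · rw [div_pow, add_assoc m r 1, pow_add]
      field_simp
      ring

lemma shiftSum_monotoneOn {e : ℕ → ℝ} (he : Admissible e) (r : ℕ) :
    MonotoneOn (shiftSum e r) (Set.Ici 0) := fun x hx _ _ hxy =>
  shiftSum_le he r (by linarith [Set.mem_Ici.1 hx]) hxy

/-- The constant weight `1`. -/
abbrev unitWeight : ℕ → ℝ := fun _ => 1

lemma shiftSum_nest_unitWeight {x : ℝ} (hx : -1 < x) :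
    shiftSum (nest unitWeight) 1 x =
      (shiftSum unitWeight 1 x ^ 2 + shiftSum unitWeight 2 x) / 2 := by
  refine eq_of_add_one_sub_eq
    (g := fun x => (shiftSum unitWeight 1 x ^ 2 + shiftSum unitWeight 2 x) / 2)
    (shiftSum_monotoneOn admissible_one.nest 1) (fun y hy z hz hyz => ?_) (by simp [shiftSum_zero])
    (fun y hy => ?_) (tendsto_shiftSum_diff admissible_one.nest) hx
  · have h1 := shiftSum_monotoneOn admissible_one 1 hy hz hyz
    have h2 := shiftSum_monotoneOn admissible_one 2 hy hz hyz
    have h3 := shiftSum_nonneg admissible_one 1 hy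
    dsimp only [unitWeight]
    gcongr
  · rw [shiftSum_nest_add_one admissible_one hy, shiftSum_one_add_one one_ne_zero hy,
      shiftSum_one_add_one two_ne_zero hy]
    ring

lemma shiftSum_nest_nest_unitWeight {x : ℝ} (hx : -1 < x) :
    shiftSum (nest (nest unitWeight)) 1 x =
      shiftSum unitWeight 1 x ^ 3 / 6 + shiftSum unitWeight 1 x * shiftSum unitWeight 2 x / 2 +
        shiftSum unitWeight 3 x / 3 := by
  refine eq_of_add_one_sub_eq (g := fun x => shiftSum unitWeight 1 x ^ 3 / 6 +
      shiftSum unitWeight 1 x * shiftSum unitWeight 2 x / 2 + shiftSum unitWeight 3 x / 3)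
    (shiftSum_monotoneOn admissible_one.nest.nest 1) (fun y hy z hz hyz => ?_)
    (by simp [shiftSum_zero]) (fun y hy => ?_)
    (tendsto_shiftSum_diff admissible_one.nest.nest) hx
  · have h1 := shiftSum_monotoneOn admissible_one 1 hy hz hyz
    have h2 := shiftSum_monotoneOn admissible_one 2 hy hz hyz
    have h3 := shiftSum_monotoneOn admissible_one 3 hy hz hyz
    have h4 := shiftSum_nonneg admissible_one 1 hy
    have h5 := shiftSum_nonneg admissible_one 2 hy
    have h6 := shiftSum_nonneg admissible_one 1 hz
    dsimp only [unitWeight]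
    gcongr
  · rw [shiftSum_nest_add_one admissible_one.nest hy, shiftSum_nest_add_one admissible_one hy,
      shiftSum_nest_unitWeight hy, shiftSum_one_add_one one_ne_zero hy,
      shiftSum_one_add_one two_ne_zero hy, shiftSum_one_add_one three_ne_zero hy]
    ring

lemma shiftSeries_nest_unitWeight :
    shiftSeries (nest unitWeight) 0 = (1 / 2 : ℝ) • (shiftSeries unitWeight 1 +
      (-1 : ℝ) • (shiftSeries unitWeight 0 * shiftSeries unitWeight 0)) := by
  have h0 := hasExpansion_shiftSeries admissible_one 0
  have h1 := hasExpansion_shiftSeries admissible_one 1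
  refine (hasExpansion_shiftSeries admissible_one.nest 0).eq_of_eqOn
    ((h1.add ((h0.mul h0).smul (-1))).smul (1 / 2)) fun x hx => ?_
  have := shiftSum_nest_unitWeight (x := -x) (by linarith [hx.2])
  rw [zero_add, this]
  ring

lemma shiftSeries_nest_nest_unitWeight :
    shiftSeries (nest (nest unitWeight)) 0 =
      (1 / 6 : ℝ) • (shiftSeries unitWeight 0 * shiftSeries unitWeight 0 *
        shiftSeries unitWeight 0) +
      (-1 / 2 : ℝ) • (shiftSeries unitWeight 0 * shiftSeries unitWeight 1) +
      (1 / 3 : ℝ) • shiftSeries unitWeight 2 := by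
  have h0 := hasExpansion_shiftSeries admissible_one 0
  have h1 := hasExpansion_shiftSeries admissible_one 1
  have h2 := hasExpansion_shiftSeries admissible_one 2
  refine (hasExpansion_shiftSeries admissible_one.nest.nest 0).eq_of_eqOn
    (((((h0.mul h0).mul h0).smul (1 / 6)).add ((h0.mul h1).smul (-1 / 2))).add (h2.smul (1 / 3)))
    fun x hx => ?_
  have := shiftSum_nest_nest_unitWeight (x := -x) (by linarith [hx.2])
  rw [zero_add, this]
  ring

lemma hasSum_prod_of_nonneg {α β : Type*} {f : α × β → ℝ} {g : α → ℝ} {s : ℝ} (hf : 0 ≤ f)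
    (hg : ∀ x, HasSum (fun y => f (x, y)) (g x)) (hs : HasSum g s) : HasSum f s := by
  have hsum : Summable f := (summable_prod_of_nonneg hf).2 ⟨fun x => (hg x).summable, by
    simpa only [fun x => (hg x).tsum_eq] using hs.summable⟩
  rw [hs.unique (hsum.hasSum.prod_fiberwise hg)]
  exact hsum.hasSum

lemma hasSum_range_ite (f : ℕ → ℝ) (n : ℕ) :
    HasSum (fun k => if k < n then f k else 0) (∑ k ∈ Finset.range n, f k) := by
  have h := hasSum_sum_of_ne_finset_zero (L := .unconditional ℕ)
    (f := fun k => if k < n then f k else 0) (s := Finset.range n)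
      (fun k hk => if_neg fun h => hk (Finset.mem_range.2 h))
  rwa [Finset.sum_congr rfl fun k hk => if_pos (Finset.mem_range.1 hk)] at h

lemma Admissible.hasSum_weightedZeta {e : ℕ → ℝ} (he : Admissible e) {a : ℕ} (ha : 2 ≤ a) :
    HasSum (fun k : ℕ => e k / ((k : ℝ) + 1) ^ a) (weightedZeta e a) := by
  refine (he.summable.of_nonneg_of_le (fun k => ?_) fun k => ?_).hasSum
  · have := he.nonneg k
    positivity
  · have := he.nonneg k
    have hk : (1 : ℝ) ≤ (k : ℝ) + 1 := by linarith [k.cast_nonneg (α := ℝ)]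
    gcongr

/-- To compute a multiple zeta value it suffices to sum over an injective parametrization of
positive indices. -/
lemma mzv_eq_of_hasSum {ks : List ℕ} {γ : Type*} {g : γ → Fin ks.length → ℕ} {s : ℝ}
    (hg : Function.Injective g) (hr : ∀ m : Fin ks.length → ℕ, (∀ i, 0 < m i) → m ∈ Set.range g)
    (hs : HasSum (fun c => if (∀ i, 0 < g c i) ∧ (∀ i j, i < j → g c j < g c i) then
      1 / ∏ i, (g c i : ℝ) ^ ks.get i else 0) s) : mzv ks = s := by
  refine HasSum.tsum_eq ((hg.hasSum_iff fun m hm => if_neg fun h => hm (hr m h.1)).1 ?_)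
  exact hs

lemma mzv_single {a : ℕ} (ha : 2 ≤ a) : mzv [a] = weightedZeta unitWeight a := by
  refine mzv_eq_of_hasSum (g := fun (k : ℕ) (_ : Fin 1) => k + 1) (fun k l h => ?_)
    (fun m hm => ⟨m 0 - 1, ?_⟩) ?_
  · have := congrFun h 0
    simpa using this
  · ext i
    rw [Fin.fin_one_eq_zero i]
    exact Nat.succ_pred_eq_of_pos (hm 0)
  · convert admissible_one.hasSum_weightedZeta ha using 2 with k
    rw [if_pos ⟨fun _ => Nat.succ_pos _, fun i j h => absurd h (by
      rw [Subsingleton.elim (α := Fin 1) i j]; exact lt_irrefl _)⟩]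
    simp

lemma mzv_pair {a : ℕ} (ha : 2 ≤ a) : mzv [a, 1] = weightedZeta (nest unitWeight) a := by
  refine mzv_eq_of_hasSum (g := fun (p : ℕ × ℕ) => ![p.1 + 1, p.2 + 1]) (fun p q h => ?_)
    (fun m hm => ⟨(m (0 : Fin 2) - 1, m (1 : Fin 2) - 1), ?_⟩) ?_
  · have h0 := congrFun h (0 : Fin 2)
    have h1 := congrFun h (1 : Fin 2)
    simp at h0 h1
    exact Prod.ext h0 h1
  · have h0 := hm (0 : Fin 2)
    have h1 := hm (1 : Fin 2)
    refine funext fun i => ?_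
    change Fin 2 at i
    fin_cases i
    · exact Nat.succ_pred_eq_of_pos h0
    · exact Nat.succ_pred_eq_of_pos h1
  · have key : ∀ p : ℕ × ℕ, (if (∀ i : Fin 2, 0 < ![p.1 + 1, p.2 + 1] i) ∧
        (∀ i j : Fin 2, i < j → ![p.1 + 1, p.2 + 1] j < ![p.1 + 1, p.2 + 1] i) then
        1 / ∏ i : Fin 2, ((![p.1 + 1, p.2 + 1] i : ℕ) : ℝ) ^ [a, 1].get i else 0) =
        if p.2 < p.1 then 1 / ((p.1 : ℝ) + 1) ^ a * (1 / ((p.2 : ℝ) + 1)) else 0 := by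
      rintro ⟨k, j⟩
      refine if_congr ?_ ?_ rfl
      · simp [Fin.forall_fin_two]
      · simp [Fin.prod_univ_two, mul_comm]
    refine Eq.mpr (congrArg (fun f => HasSum f _) (funext key)) ?_
    refine hasSum_prod_of_nonneg (fun p => ?_) (fun k => ?_)
      (admissible_one.nest.hasSum_weightedZeta ha)
    · dsimp only [Pi.zero_apply]
      positivity
    · convert hasSum_range_ite (fun j : ℕ => 1 / ((k : ℝ) + 1) ^ a * (1 / ((j : ℝ) + 1))) k using 1
      rw [← Finset.mul_sum, nest]
      ring

lemma mzv_triple {a : ℕ} (ha : 2 ≤ a) :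
    mzv [a, 1, 1] = weightedZeta (nest (nest unitWeight)) a := by
  refine mzv_eq_of_hasSum (g := fun (p : ℕ × ℕ × ℕ) => ![p.1 + 1, p.2.1 + 1, p.2.2 + 1])
    (fun p q h => ?_)
    (fun m hm => ⟨(m (0 : Fin 3) - 1, m (1 : Fin 3) - 1, m (2 : Fin 3) - 1), ?_⟩) ?_
  · have h0 := congrFun h (0 : Fin 3)
    have h1 := congrFun h (1 : Fin 3)
    have h2 := congrFun h (2 : Fin 3)
    simp at h0 h1 h2
    exact Prod.ext h0 (Prod.ext h1 h2)
  · have h0 := hm (0 : Fin 3)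
    have h1 := hm (1 : Fin 3)
    have h2 := hm (2 : Fin 3)
    refine funext fun i => ?_
    change Fin 3 at i
    fin_cases i
    · exact Nat.succ_pred_eq_of_pos h0
    · exact Nat.succ_pred_eq_of_pos h1
    · exact Nat.succ_pred_eq_of_pos h2
  · have key : ∀ p : ℕ × ℕ × ℕ,
        (if (∀ i : Fin 3, 0 < ![p.1 + 1, p.2.1 + 1, p.2.2 + 1] i) ∧
        (∀ i j : Fin 3, i < j → ![p.1 + 1, p.2.1 + 1, p.2.2 + 1] j <
          ![p.1 + 1, p.2.1 + 1, p.2.2 + 1] i) then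
        1 / ∏ i : Fin 3, ((![p.1 + 1, p.2.1 + 1, p.2.2 + 1] i : ℕ) : ℝ) ^ [a, 1, 1].get i
          else 0) =
        if p.2.1 < p.1 then 1 / ((p.1 : ℝ) + 1) ^ a * (if p.2.2 < p.2.1 then
          1 / ((p.2.1 : ℝ) + 1) * (1 / ((p.2.2 : ℝ) + 1)) else 0) else 0 := by
      rintro ⟨k, j, i⟩
      rw [mul_ite_zero, ← ite_and]
      refine if_congr ?_ ?_ rfl
      · simp [Fin.forall_fin_succ]
        omega
      · simp [Fin.prod_univ_three]
        ring
    refine Eq.mpr (congrArg (fun f => HasSum f _) (funext key)) ?_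
    refine hasSum_prod_of_nonneg (fun p => ?_) (fun k => ?_)
      (admissible_one.nest.nest.hasSum_weightedZeta ha)
    · dsimp only [Pi.zero_apply]
      positivity
    · refine hasSum_prod_of_nonneg (fun p => ?_) (fun j => ?_) (?_ : HasSum
        (fun j : ℕ => if j < k then 1 / ((k : ℝ) + 1) ^ a * (nest unitWeight j / ((j : ℝ) + 1))
          else 0) _)
      · dsimp only [Pi.zero_apply]
        positivity
      · dsimp only
        split_ifs
        · have := (hasSum_range_ite
            (fun i : ℕ => 1 / ((j : ℝ) + 1) * (1 / ((i : ℝ) + 1))) j).mul_left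
              (1 / ((k : ℝ) + 1) ^ a)
          rw [← Finset.mul_sum] at this
          have hn : nest unitWeight j / ((j : ℝ) + 1) =
              1 / ((j : ℝ) + 1) * ∑ i ∈ Finset.range j, 1 / ((i : ℝ) + 1) := by
            rw [nest]
            ring
          rwa [hn]
        · exact hasSum_zero
      · convert hasSum_range_ite (fun j : ℕ =>
          1 / ((k : ℝ) + 1) ^ a * (nest unitWeight j / ((j : ℝ) + 1))) k using 1
        rw [← Finset.mul_sum, nest]
        ring

/-- The Euler operator `X · d/dX` on power series. -/
noncomputable def euler {R : Type*} [CommRing R] (F : PowerSeries R) : PowerSeries R :=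
  X * derivative R F

lemma coeff_euler {R : Type*} [CommRing R] (F : PowerSeries R) (n : ℕ) :
    coeff n (euler F) = n * coeff n F := by
  cases n with
  | zero => simp [euler]
  | succ n =>
    rw [euler, coeff_succ_X_mul, coeff_derivative]
    push_cast
    ring

lemma euler_mul {R : Type*} [CommRing R] (F G : PowerSeries R) :
    euler (F * G) = euler F * G + F * euler G := by
  rw [euler, Derivation.leibniz, euler, euler, smul_eq_mul, smul_eq_mul]
  ring

lemma euler_rescale {R : Type*} [CommRing R] (c : R) (F : PowerSeries R) :
    euler (rescale c F) = rescale c (euler F) := by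
  ext n
  simp only [coeff_euler, coeff_rescale]
  ring

lemma euler_bernoulliPowerSeries :
    euler (bernoulliPowerSeries ℂ) = bernoulliPowerSeries ℂ - bernoulliPowerSeries ℂ ^ 2 -
      X * bernoulliPowerSeries ℂ := by
  have h := bernoulliPowerSeries_mul_exp_sub_one ℂ
  have hne : exp ℂ - 1 ≠ 0 := fun h0 => by
    rw [h0, mul_zero] at h
    exact X_ne_zero h.symm
  have hd := congrArg (derivative ℂ) h
  rw [Derivation.leibniz, map_sub, derivative_exp, Derivation.map_one_eq_zero, sub_zero,
    derivative_X, smul_eq_mul, smul_eq_mul] at hd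
  refine mul_right_cancel₀ hne ?_
  rw [euler]
  linear_combination X * hd + (bernoulliPowerSeries ℂ - 1) * h

/-- The even function `x/(exp x - 1) + x/2` as a power series. -/
noncomputable def evenBernoulli : PowerSeries ℂ := bernoulliPowerSeries ℂ + C (1 / 2) * X

lemma evenBernoulli_mul_self :
    evenBernoulli * evenBernoulli = evenBernoulli - euler evenBernoulli + C (1 / 4) * X ^ 2 := by
  have hX : euler evenBernoulli = euler (bernoulliPowerSeries ℂ) + C (1 / 2) * X := by
    ext n
    simp only [evenBernoulli, coeff_euler, map_add, coeff_C_mul, coeff_X]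
    split_ifs with hn
    · subst hn
      push_cast
      ring
    · ring
  rw [hX, euler_bernoulliPowerSeries, evenBernoulli]
  have h2 : (C (1 / 2 : ℂ) : PowerSeries ℂ) * 2 = 1 := by
    rw [show (2 : PowerSeries ℂ) = C (2 : ℂ) from (map_ofNat C 2).symm, ← map_mul]
    norm_num
  have h4 : (C (1 / 4 : ℂ) : PowerSeries ℂ) = C (1 / 2 : ℂ) * C (1 / 2 : ℂ) := by
    rw [← map_mul]
    norm_num
  rw [h4]
  linear_combination (X * bernoulliPowerSeries ℂ) * h2

lemma coeff_evenBernoulli_of_even {n : ℕ} (hn : Even n) :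
    coeff n evenBernoulli = (bernoulli n : ℂ) / n.factorial := by
  have h1 : n ≠ 1 := by
    rintro rfl
    exact Nat.not_even_one hn
  simp [evenBernoulli, bernoulliPowerSeries, coeff_X, h1]

lemma coeff_evenBernoulli_of_odd {n : ℕ} (hn : Odd n) : coeff n evenBernoulli = 0 := by
  rcases eq_or_ne n 1 with rfl | h1
  · norm_num [evenBernoulli, bernoulliPowerSeries]
  · have : 1 < n := by
      have := hn.pos
      omega
    simp [evenBernoulli, bernoulliPowerSeries, coeff_X, h1, bernoulli_eq_zero_of_odd hn this]

lemma mzv_two_mul {k : ℕ} (hk : k ≠ 0) : mzv [2 * k] =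
    (-1) ^ (k + 1) * 2 ^ (2 * k - 1) * Real.pi ^ (2 * k) * (bernoulli (2 * k) : ℝ) /
      (2 * k).factorial := by
  rw [mzv_single (by omega), weightedZeta]
  have h := (hasSum_nat_add_iff' 1).2 (hasSum_zeta_nat hk)
  rw [Finset.sum_range_one, Nat.cast_zero, zero_pow (by omega), div_zero, sub_zero] at h
  exact_mod_cast h.tsum_eq

lemma mzv_two : mzv [2] = Real.pi ^ 2 / 6 := by
  rw [show 2 = 2 * 1 from rfl, mzv_two_mul one_ne_zero]
  norm_num [bernoulli_two]
  ring

/-- The generating series of zeta values. -/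
noncomputable def zetaSeries : PowerSeries ℝ := .mk fun a => if 2 ≤ a then mzv [a] else 0

/-- The generating series of zeta values at even integers. -/
noncomputable def evenZetaSeries : PowerSeries ℝ :=
  .mk fun a => if 2 ≤ a ∧ Even a then mzv [a] else 0

/-- The generating series of zeta values at odd integers. -/
noncomputable def oddZetaSeries : PowerSeries ℝ :=
  .mk fun a => if 2 ≤ a ∧ Odd a then mzv [a] else 0

lemma zetaSeries_eq : zetaSeries = evenZetaSeries + oddZetaSeries := by
  ext n
  rcases Nat.even_or_odd n with h | h
  · simp [zetaSeries, evenZetaSeries, oddZetaSeries, h]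
  · simp [zetaSeries, evenZetaSeries, oddZetaSeries, h]

lemma map_evenZetaSeries : map Complex.ofRealHom evenZetaSeries =
    C (1 / 2) * (1 - rescale (2 * Real.pi * Complex.I) evenBernoulli) := by
  ext n
  rw [coeff_map, coeff_C_mul, map_sub, coeff_rescale, evenZetaSeries, coeff_mk, coeff_one]
  rcases Nat.even_or_odd n with h | h
  · rw [coeff_evenBernoulli_of_even h]
    rcases Nat.eq_zero_or_pos n with rfl | hpos
    · simp
    · obtain ⟨k, rfl⟩ := h.two_dvd
      have hk : k ≠ 0 := by omega
      rw [if_pos ⟨by omega, h⟩, if_neg (by omega), mzv_two_mul hk, mul_pow, mul_pow,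
        pow_mul Complex.I, Complex.I_sq]
      obtain ⟨l, rfl⟩ := Nat.exists_eq_succ_of_ne_zero hk
      rw [show 2 * l.succ - 1 = 2 * l + 1 by omega, show 2 * l.succ = 2 * l + 2 by omega]
      simp only [Complex.ofRealHom_eq_coe]
      push_cast
      ring
  · rw [coeff_evenBernoulli_of_odd h, if_neg fun h' => Nat.not_even_iff_odd.2 h h'.2,
      if_neg h.pos.ne']
    simp

lemma evenZetaSeries_mul_self : evenZetaSeries * evenZetaSeries =
    C (1 / 2) * (euler evenZetaSeries + evenZetaSeries) - C (Real.pi ^ 2 / 4) * X ^ 2 := by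
  have hinj : Function.Injective (PowerSeries.map Complex.ofRealHom) := map_injective _ Complex.ofReal_injective
  apply hinj
  have heul : map Complex.ofRealHom (euler evenZetaSeries) =
      -(C (1 / 2) * rescale (2 * Real.pi * Complex.I) (euler evenBernoulli)) := by
    have : map Complex.ofRealHom (euler evenZetaSeries) =
        euler (map Complex.ofRealHom evenZetaSeries) := by
      ext n
      simp [coeff_euler]
    rw [this, map_evenZetaSeries, ← euler_rescale]
    ext n
    simp only [coeff_euler, coeff_C_mul, map_sub, map_neg, coeff_one]
    split_ifs with hn
    · subst hn
      simp
    · ring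
  have hmul := congrArg (rescale (2 * Real.pi * Complex.I)) evenBernoulli_mul_self
  have hX : rescale (2 * Real.pi * Complex.I) (C (1 / 4) * X ^ 2) =
      C (-(Real.pi ^ 2 : ℂ)) * X ^ 2 := by
    ext n
    simp only [coeff_rescale, coeff_C_mul, coeff_X_pow]
    split_ifs with hn
    · subst hn
      linear_combination (Real.pi ^ 2 : ℂ) * Complex.I_sq
    · simp
  rw [map_mul, map_add, map_sub, hX] at hmul
  rw [map_mul, map_sub, map_mul, map_mul, map_add, heul, map_evenZetaSeries, map_pow, map_X, map_C,
    map_C]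
  have h2 : (C (Complex.ofRealHom (1 / 2)) : PowerSeries ℂ) = C (1 / 2 : ℂ) := by
    simp
  have h4 : (C (Complex.ofRealHom (Real.pi ^ 2 / 4)) : PowerSeries ℂ) =
      -(C (1 / 2 : ℂ) * C (1 / 2 : ℂ) * C (-(Real.pi ^ 2 : ℂ))) := by
    rw [← map_mul, ← map_mul, ← map_neg]
    congr 1
    simp only [Complex.ofRealHom_eq_coe]
    push_cast
    ring
  rw [h2, h4]
  linear_combination C (1 / 2 : ℂ) * C (1 / 2 : ℂ) * hmul

/-- All monomials of `F` have degree congruent to `a` modulo `2`. -/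
def HasParity (a : ℕ) (F : PowerSeries ℝ) : Prop := ∀ n, coeff n F ≠ 0 → n % 2 = a % 2

lemma HasParity.mul {a b : ℕ} {F G : PowerSeries ℝ} (hF : HasParity a F) (hG : HasParity b G) :
    HasParity (a + b) (F * G) := by
  intro n hn
  rw [coeff_mul] at hn
  obtain ⟨p, hp, hne⟩ := Finset.exists_ne_zero_of_sum_ne_zero hn
  have h1 := hF _ (left_ne_zero_of_mul hne)
  have h2 := hG _ (right_ne_zero_of_mul hne)
  have h3 := Finset.HasAntidiagonal.mem_antidiagonal.1 hp
  omega

lemma HasParity.euler {a : ℕ} {F : PowerSeries ℝ} (hF : HasParity a F) :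
    HasParity a (euler F) := fun n hn => hF n (right_ne_zero_of_mul (coeff_euler F n ▸ hn))

lemma HasParity.coeff_eq_zero {F : PowerSeries ℝ} (hF : HasParity 1 F) {n : ℕ} (hn : Even n) :
    coeff n F = 0 := by
  by_contra h
  have := hF n h
  rw [Nat.even_iff] at hn
  omega

lemma hasParity_evenZetaSeries : HasParity 0 evenZetaSeries := fun n hn => by
  rw [evenZetaSeries, coeff_mk] at hn
  exact Nat.even_iff.1 (by_contra fun h => hn (if_neg fun h' => h h'.2))

lemma hasParity_oddZetaSeries : HasParity 1 oddZetaSeries := fun n hn => by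
  rw [oddZetaSeries, coeff_mk] at hn
  exact Nat.odd_iff.1 (by_contra fun h => hn (if_neg fun h' => h h'.2))

/-- The series `∑_{a ≥ 3} (a-1) ζ(a) X^a`. -/
noncomputable def derivedZetaSeries : PowerSeries ℝ :=
  euler zetaSeries - zetaSeries - C (mzv [2]) * X ^ 2

lemma coeff_derivedZetaSeries (a : ℕ) :
    coeff a derivedZetaSeries = if 3 ≤ a then ((a : ℝ) - 1) * mzv [a] else 0 := by
  simp only [derivedZetaSeries, zetaSeries, map_sub, coeff_euler, coeff_mk, coeff_C_mul,
    coeff_X_pow]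
  rcases lt_trichotomy a 2 with h | rfl | h
  · rw [if_neg (by omega), if_neg (by omega), if_neg (by omega)]
    ring
  · norm_num
    ring
  · rw [if_pos h.le, if_neg h.ne', if_pos (show 3 ≤ a from h)]
    ring

lemma X_mul_shiftSeries_zero : X * shiftSeries unitWeight 0 = zetaSeries := by
  ext n
  rw [zetaSeries, coeff_mk]
  cases n with
  | zero => simp
  | succ n =>
    rw [coeff_succ_X_mul, shiftSeries, coeff_mk]
    rcases Nat.eq_zero_or_pos n with rfl | hn
    · simp
    · rw [if_neg hn.ne', if_pos (by omega), mzv_single (by omega)]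
      simp

lemma X_sq_mul_shiftSeries_one : X ^ 2 * shiftSeries unitWeight 1 = derivedZetaSeries := by
  ext n
  rw [coeff_X_pow_mul', coeff_derivedZetaSeries]
  rcases lt_trichotomy n 2 with h | rfl | h
  · rw [if_neg (by omega), if_neg (by omega)]
  · simp [shiftSeries]
  · obtain ⟨k, rfl⟩ := Nat.exists_eq_add_of_lt h
    rw [if_pos (by omega), if_pos (by omega), shiftSeries, coeff_mk, if_neg (by omega),
      mzv_single (by omega), show 2 + k + 1 - 2 = k + 1 by omega,
      show 2 + k + 1 = k + 1 + 1 + 1 by omega, Nat.choose_one_right]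
    push_cast
    ring

lemma coeff_mul_X_pow_add (F : PowerSeries ℝ) (n d : ℕ) :
    coeff n F = coeff (n + d) (X ^ d * F) := by
  rw [coeff_X_pow_mul', if_pos (Nat.le_add_left d n), Nat.add_sub_cancel]

/-- Euler's evaluation of `ζ(m+1, 1)`. -/
lemma mzv_pair_eq {m : ℕ} (hm : 1 ≤ m) : mzv [m + 1, 1] =
    (((m : ℝ) + 1) * mzv [m + 2] - coeff (m + 2) (zetaSeries * zetaSeries)) / 2 := by
  have h := congrArg (coeff m) shiftSeries_nest_unitWeight
  rw [map_smul, map_add, map_smul, coeff_mul_X_pow_add (shiftSeries unitWeight 1) m 2,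
    X_sq_mul_shiftSeries_one, coeff_mul_X_pow_add (_ * _) m 2,
    show X ^ 2 * (shiftSeries unitWeight 0 * shiftSeries unitWeight 0) =
      (X * shiftSeries unitWeight 0) * (X * shiftSeries unitWeight 0) by ring,
    X_mul_shiftSeries_zero, shiftSeries, coeff_mk, if_neg (by omega), coeff_derivedZetaSeries,
    if_pos (by omega), add_zero, ← mzv_pair (by omega), Nat.choose_zero_right] at h
  simp only [smul_eq_mul] at h
  push_cast at h
  linarith

/-- Evaluation of `ζ(m, 1, 1)` in terms of zeta values. -/
lemma mzv_triple_eq {m : ℕ} (hm : 2 ≤ m) : mzv [m, 1, 1] =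
    coeff (m + 2) (zetaSeries * zetaSeries * zetaSeries) / 6 -
      coeff (m + 2) (zetaSeries * derivedZetaSeries) / 2 +
      (m : ℝ) * ((m : ℝ) + 1) / 6 * mzv [m + 2] := by
  obtain ⟨n, rfl⟩ := Nat.exists_eq_add_of_le' (show 1 ≤ m by omega)
  have h := congrArg (coeff n) shiftSeries_nest_nest_unitWeight
  have h2 : coeff n (shiftSeries unitWeight 2) =
      ((n : ℝ) + 1) * ((n : ℝ) + 2) / 2 * mzv [n + 1 + 2] := by
    rw [shiftSeries, coeff_mk, if_neg (by omega), mzv_single (by omega), Nat.cast_choose_two]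
    push_cast
    ring
  rw [map_add, map_add, map_smul, map_smul, map_smul, h2, coeff_mul_X_pow_add (_ * _ * _) n 3,
    coeff_mul_X_pow_add (_ * shiftSeries unitWeight 1) n 3,
    show X ^ 3 * (shiftSeries unitWeight 0 * shiftSeries unitWeight 0 * shiftSeries unitWeight 0) =
      (X * shiftSeries unitWeight 0) * (X * shiftSeries unitWeight 0) *
        (X * shiftSeries unitWeight 0) by ring,
    show X ^ 3 * (shiftSeries unitWeight 0 * shiftSeries unitWeight 1) =
      (X * shiftSeries unitWeight 0) * (X ^ 2 * shiftSeries unitWeight 1) by ring,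
    X_mul_shiftSeries_zero, X_sq_mul_shiftSeries_one, shiftSeries, coeff_mk, if_neg (by omega),
    add_zero, ← mzv_triple (by omega), Nat.choose_zero_right] at h
  simp only [smul_eq_mul] at h
  push_cast at h ⊢
  rw [show n + 1 + 2 = n + 3 from rfl] at *
  linarith

lemma sum_eq_coeff_derivedZetaSeries_mul (m : ℕ) :
    (∑ p ∈ (Finset.range (m + 1) ×ˢ Finset.range (m + 1)).filter
        (fun p => 1 ≤ p.1 ∧ 1 ≤ p.2 ∧ p.1 + 2 * p.2 = m),
      ((p.1 : ℝ) + 1) * mzv [p.1 + 2] * mzv [2 * p.2]) =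
      coeff (m + 2) (derivedZetaSeries * evenZetaSeries) := by
  rw [coeff_mul]
  refine Finset.sum_of_injOn (fun p => (p.1 + 2, 2 * p.2)) ?_ ?_ ?_ ?_
  · rintro ⟨a, b⟩ - ⟨c, d⟩ - h
    simp only [Prod.mk.injEq] at h ⊢
    omega
  · rintro ⟨a, b⟩ h
    simp only [Finset.coe_filter, Finset.mem_product, Finset.mem_range, Set.mem_ofPred_eq,
      Finset.mem_coe, Finset.HasAntidiagonal.mem_antidiagonal] at h ⊢
    omega
  · rintro ⟨a, b⟩ h hne
    rw [Finset.HasAntidiagonal.mem_antidiagonal] at h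
    by_contra h0
    have ha := left_ne_zero_of_mul h0
    have hb := right_ne_zero_of_mul h0
    rw [coeff_derivedZetaSeries, ne_eq, ite_eq_right_iff, Classical.not_imp] at ha
    rw [evenZetaSeries, coeff_mk, ne_eq, ite_eq_right_iff, Classical.not_imp] at hb
    obtain ⟨k, rfl⟩ := hb.1.2.two_dvd
    refine hne ⟨(a - 2, k), ?_, ?_⟩
    · simp only [Finset.coe_filter, Finset.mem_product, Finset.mem_range, Set.mem_ofPred_eq]
      dsimp only at *
      omega
    · simp only [Prod.mk.injEq, and_true]
      dsimp only at *
      omega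
  · rintro ⟨a, b⟩ h
    simp only [Finset.mem_filter, Finset.mem_product, Finset.mem_range] at h
    dsimp only
    rw [coeff_derivedZetaSeries, if_pos (by omega), evenZetaSeries, coeff_mk,
      if_pos ⟨by omega, even_two_mul b⟩]
    push_cast
    ring

lemma sum_eq_coeff_zetaSeries_mul (m : ℕ) :
    (∑ t ∈ ((Finset.range (m + 1) ×ˢ Finset.range (m + 1)) ×ˢ Finset.range (m + 1)).filter
        (fun t => 1 ≤ t.1.1 ∧ 1 ≤ t.1.2 ∧ 1 ≤ t.2 ∧ t.1.1 + t.1.2 + 2 * t.2 = m),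
      mzv [t.1.1 + 1] * mzv [t.1.2 + 1] * mzv [2 * t.2]) =
      coeff (m + 2) (zetaSeries * zetaSeries * evenZetaSeries) := by
  rw [coeff_mul]
  simp only [coeff_mul _ zetaSeries zetaSeries, Finset.sum_mul]
  rw [Finset.sum_sigma']
  refine Finset.sum_of_injOn
    (fun t => ⟨(t.1.1 + 1 + (t.1.2 + 1), 2 * t.2), (t.1.1 + 1, t.1.2 + 1)⟩) ?_ ?_ ?_ ?_
  · rintro ⟨⟨a, b⟩, c⟩ - ⟨⟨d, e⟩, f⟩ - h
    simp only [Sigma.mk.injEq, Prod.mk.injEq, heq_eq_eq] at h ⊢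
    omega
  · rintro ⟨⟨a, b⟩, c⟩ h
    simp only [Finset.coe_filter, Finset.mem_product, Finset.mem_range, Set.mem_ofPred_eq,
      Finset.mem_coe, Finset.mem_sigma, Finset.HasAntidiagonal.mem_antidiagonal] at h ⊢
    exact ⟨by omega, trivial⟩
  · rintro ⟨⟨s, c⟩, ⟨a, b⟩⟩ h hne
    simp only [Finset.mem_sigma, Finset.HasAntidiagonal.mem_antidiagonal] at h
    by_contra h0
    have hab := left_ne_zero_of_mul h0
    have ha := left_ne_zero_of_mul hab
    have hb := right_ne_zero_of_mul hab
    have hc := right_ne_zero_of_mul h0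
    rw [zetaSeries, coeff_mk, ne_eq, ite_eq_right_iff, Classical.not_imp] at ha hb
    rw [evenZetaSeries, coeff_mk, ne_eq, ite_eq_right_iff, Classical.not_imp] at hc
    obtain ⟨k, hk⟩ := hc.1.2.two_dvd
    obtain ⟨rfl, h2⟩ := And.intro h.2 h.1
    dsimp only at *
    refine hne ⟨((a - 1, b - 1), k), ?_, ?_⟩
    · simp only [Finset.coe_filter, Finset.mem_product, Finset.mem_range, Set.mem_ofPred_eq]
      omega
    · simp only [Nat.sub_add_cancel (show 1 ≤ a by omega),
        Nat.sub_add_cancel (show 1 ≤ b by omega), hk]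
  · rintro ⟨⟨a, b⟩, c⟩ h
    simp only [Finset.mem_filter, Finset.mem_product, Finset.mem_range] at h
    dsimp only
    rw [zetaSeries, coeff_mk, coeff_mk, if_pos (by omega), if_pos (by omega), evenZetaSeries,
      coeff_mk, if_pos ⟨by omega, even_two_mul c⟩]

lemma coeff_mul_euler_self (F : PowerSeries ℝ) (n : ℕ) :
    coeff n (F * euler F) = n / 2 * coeff n (F * F) := by
  have h := congrArg (coeff n) (euler_mul F F)
  rw [coeff_euler, mul_comm (euler F) F, map_add] at h
  linarith

end MZVRelation

open PowerSeries MZVRelation in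
/-- For even `m ≥ 2`:
`2·ζ(m,1,1) = m·ζ(m+1,1) + (π²/2)ζ(m) − ((m+1)(m+2)/2)ζ(m+2) + ∑_{i+2k=m}(i+1)ζ(i+2)ζ(2k)
  + ∑_{i+j+2k=m} ζ(i+1)ζ(j+1)ζ(2k)`. -/
theorem triple_zeta_relation_even (m : ℕ) (hm : 2 ≤ m) (heven : Even m) :
    2 * mzv [m, 1, 1] =
      (m : ℝ) * mzv [m + 1, 1] + Real.pi ^ 2 / 2 * mzv [m] -
        ((m : ℝ) + 1) * ((m : ℝ) + 2) / 2 * mzv [m + 2] +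
        (∑ p ∈ (Finset.range (m + 1) ×ˢ Finset.range (m + 1)).filter
            (fun p => 1 ≤ p.1 ∧ 1 ≤ p.2 ∧ p.1 + 2 * p.2 = m),
          ((p.1 : ℝ) + 1) * mzv [p.1 + 2] * mzv [2 * p.2]) +
        ∑ t ∈ ((Finset.range (m + 1) ×ˢ Finset.range (m + 1)) ×ˢ Finset.range (m + 1)).filter
            (fun t => 1 ≤ t.1.1 ∧ 1 ≤ t.1.2 ∧ 1 ≤ t.2 ∧ t.1.1 + t.1.2 + 2 * t.2 = m),
          mzv [t.1.1 + 1] * mzv [t.1.2 + 1] * mzv [2 * t.2] := by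
  have hM : Even (m + 2) := heven.add even_two
  set P := evenZetaSeries with hP
  set Q := oddZetaSeries with hQ
  have pP : HasParity 0 P := hasParity_evenZetaSeries
  have pQ : HasParity 1 Q := hasParity_oddZetaSeries
  have hPm : coeff m P = mzv [m] := by rw [hP, evenZetaSeries, coeff_mk, if_pos ⟨hm, heven⟩]
  have hZm : coeff m zetaSeries = mzv [m] := by rw [zetaSeries, coeff_mk, if_pos hm]
  have hPM : coeff (m + 2) P = mzv [m + 2] := by
    rw [hP, evenZetaSeries, coeff_mk, if_pos ⟨by omega, hM⟩]
  have hX (F : PowerSeries ℝ) (c : ℝ) : coeff (m + 2) (C c * (X ^ 2 * F)) = c * coeff m F := by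
    rw [coeff_C_mul, ← coeff_mul_X_pow_add]
  have hPPQ : coeff (m + 2) (P * P * Q) = 0 := ((pP.mul pP).mul pQ).coeff_eq_zero hM
  have hQQQ : coeff (m + 2) (Q * Q * Q) = 0 := by
    by_contra h
    have := (pQ.mul pQ).mul pQ _ h
    rw [Nat.even_iff] at hM
    omega
  have hPQ : coeff (m + 2) (P * Q) = 0 := (pP.mul pQ).coeff_eq_zero hM
  have hPeQ : coeff (m + 2) (P * euler Q) = 0 := (pP.mul pQ.euler).coeff_eq_zero hM
  have hPP : coeff (m + 2) (P * P) = ((m : ℝ) + 3) / 2 * mzv [m + 2] := by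
    rw [evenZetaSeries_mul_self, map_sub, coeff_C_mul, coeff_C_mul, map_add, coeff_euler, hPM,
      coeff_X_pow, if_neg (by omega)]
    push_cast
    ring
  have hPPP : coeff (m + 2) (P * P * P) =
      ((m : ℝ) + 4) / 4 * coeff (m + 2) (P * P) - Real.pi ^ 2 / 4 * mzv [m] := by
    have : P * P * P = C (1 / 2) * (P * euler P + P * P) - C (Real.pi ^ 2 / 4) * (X ^ 2 * P) := by
      linear_combination P * evenZetaSeries_mul_self
    rw [this, map_sub, coeff_C_mul, map_add, coeff_mul_euler_self, hX, hPm]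
    push_cast
    ring
  have hZZZ : coeff (m + 2) (zetaSeries * zetaSeries * zetaSeries) =
      coeff (m + 2) (P * P * P) + 3 * coeff (m + 2) (P * Q * Q) := by
    have : zetaSeries * zetaSeries * zetaSeries =
        P * P * P + P * P * Q + P * P * Q + P * P * Q + P * Q * Q + P * Q * Q + P * Q * Q +
          Q * Q * Q := by
      rw [zetaSeries_eq]
      ring
    simp only [this, map_add, hPPQ, hQQQ]
    ring
  have hZZP : coeff (m + 2) (zetaSeries * zetaSeries * P) =
      coeff (m + 2) (P * P * P) + coeff (m + 2) (P * Q * Q) := by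
    have : zetaSeries * zetaSeries * P = P * P * P + P * P * Q + P * P * Q + P * Q * Q := by
      rw [zetaSeries_eq]
      ring
    simp only [this, map_add, hPPQ]
    ring
  have hZW : coeff (m + 2) (zetaSeries * derivedZetaSeries) =
      (m : ℝ) / 2 * coeff (m + 2) (zetaSeries * zetaSeries) - mzv [2] * mzv [m] := by
    have : zetaSeries * derivedZetaSeries = zetaSeries * euler zetaSeries -
        zetaSeries * zetaSeries - C (mzv [2]) * (X ^ 2 * zetaSeries) := by
      rw [derivedZetaSeries]
      ring
    rw [this, map_sub, map_sub, coeff_mul_euler_self, hX, hZm]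
    push_cast
    ring
  have hWP : coeff (m + 2) (derivedZetaSeries * P) =
      (m : ℝ) / 2 * coeff (m + 2) (P * P) - mzv [2] * mzv [m] := by
    have hadd : euler (P + Q) = euler P + euler Q := by
      rw [euler, euler, euler, map_add, mul_add]
    have : derivedZetaSeries * P = P * euler P + P * euler Q -
        P * P - P * Q - C (mzv [2]) * (X ^ 2 * P) := by
      rw [derivedZetaSeries, zetaSeries_eq, hadd]
      ring
    rw [this, map_sub, map_sub, map_sub, map_add, coeff_mul_euler_self, hX, hPm, hPeQ, hPQ]
    push_cast
    ring
  rw [sum_eq_coeff_derivedZetaSeries_mul, sum_eq_coeff_zetaSeries_mul, mzv_triple_eq hm,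
    mzv_pair_eq (by omega), hZZZ, hZZP, hZW, hWP, hPPP, hPP, mzv_two]
  ring
end
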